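/- arXiv:2010.04223 — 3 statements merged into one kernel-verified Lean document; each statement's English description precedes it below -/
import Mathlib

section
/- In the model-based fictitious play under Assumption 1, fix a state s ∈ S. For n ≥ 0 let k_n be the smallest stage k with c(s,k) = n, set x_{s,n} := (π̂_{1,s,k_n}, π̂_{2,s,k_n}, Q̂_{1,s,k_n}, Q̂_{2,s,k_n}) ∈ X, set t_n := Σ_{ι<n} α_ι, and let w_s : [0,∞) → X be the piecewise affine interpolation determined by w_s(t_n) = x_{s,n} and affine on each interval [t_n, t_{n+1}]. Then w_s is a bounded perturbed solution of the differential inclusion dx/dt ∈ F(x): w_s takes values in the compact set X, and there exists a function δ : [0,∞) → [0,∞) with δ(t) → 0 as t → ∞ such that for almost every t ≥ 0 the derivative w_s'(t) exists and w_s'(t) ∈ F^{δ(t)}(w_s(t)), where F^δ(x) := {y : there exists z with ‖z − x‖ < δ and inf_{u ∈ F(z)} ‖y − u‖ < δ}. -/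
open Finset Filter Topology

/-- Model-based fictitious play in a finite two-player zero-sum stochastic game. -/
structure MBFP (S A1 A2 : Type) [Fintype S] [Fintype A1] [Fintype A2]
    [Nonempty S] [Nonempty A1] [Nonempty A2]
    [DecidableEq S] [DecidableEq A1] [DecidableEq A2] where
  /-- stage payoff of player 1 -/
  r1 : S → A1 → A2 → ℝ
  /-- stage payoff of player 2 -/
  r2 : S → A1 → A2 → ℝ
  /-- transition probabilities: `p s a b s'` is the probability of moving to `s'` -/
  p : S → A1 → A2 → S → ℝ
  /-- discount factor -/
  γ : ℝ
  zerosum : ∀ s a b, r1 s a b + r2 s a b = 0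
  p_nonneg : ∀ s a b s', 0 ≤ p s a b s'
  p_sum_one : ∀ s a b, ∑ s', p s a b s' = 1
  γ_nonneg : 0 ≤ γ
  γ_lt_one : γ < 1
  /-- the realized state sequence -/
  st : ℕ → S
  /-- step sizes for beliefs on strategies -/
  α : ℕ → ℝ
  /-- step sizes for beliefs on Q-functions -/
  β : ℕ → ℝ
  α_mem : ∀ c, α c ∈ Set.Ioc (0:ℝ) 1
  β_mem : ∀ c, β c ∈ Set.Ioc (0:ℝ) 1
  /-- belief (held by player 2) on player 1's mixed action at each state -/
  π1 : S → ℕ → A1 → ℝ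
  /-- belief (held by player 1) on player 2's mixed action at each state -/
  π2 : S → ℕ → A2 → ℝ
  /-- player 1's belief on its own Q-function -/
  Q1 : S → ℕ → A1 → A2 → ℝ
  /-- player 2's belief on its own Q-function -/
  Q2 : S → ℕ → A1 → A2 → ℝ
  /-- best-response action of player 1 at stage k -/
  astar1 : ℕ → A1
  /-- best-response action of player 2 at stage k -/
  astar2 : ℕ → A2
  π1_simplex : ∀ s k, π1 s k ∈ stdSimplex ℝ A1
  π2_simplex : ∀ s k, π2 s k ∈ stdSimplex ℝ A2
  Q1_init : ∀ s, Q1 s 0 = r1 s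
  Q2_init : ∀ s, Q2 s 0 = r2 s
  astar1_br : ∀ k b,
    ∑ b2, Q1 (st k) k b b2 * π2 (st k) k b2
      ≤ ∑ b2, Q1 (st k) k (astar1 k) b2 * π2 (st k) k b2
  astar2_br : ∀ k b,
    ∑ b1, π1 (st k) k b1 * Q2 (st k) k b1 b
      ≤ ∑ b1, π1 (st k) k b1 * Q2 (st k) k b1 (astar2 k)
  π1_upd : ∀ s k, π1 s (k+1) = fun b =>
    π1 s k b + (if s = st k then α (((Finset.range k).filter fun k' => st k' = s).card) else 0)
      * ((if b = astar1 k then (1:ℝ) else 0) - π1 s k b)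
  π2_upd : ∀ s k, π2 s (k+1) = fun b =>
    π2 s k b + (if s = st k then α (((Finset.range k).filter fun k' => st k' = s).card) else 0)
      * ((if b = astar2 k then (1:ℝ) else 0) - π2 s k b)
  Q1_upd : ∀ s k, Q1 s (k+1) = fun b1 b2 =>
    Q1 s k b1 b2
      + (if s = st k then β (((Finset.range k).filter fun k' => st k' = s).card) else 0)
        * (r1 s b1 b2
          + γ * ∑ s', (Finset.univ.sup' Finset.univ_nonempty fun c1 =>
              ∑ b2', Q1 s' k c1 b2' * π2 s' k b2') * p s b1 b2 s'
          - Q1 s k b1 b2)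
  Q2_upd : ∀ s k, Q2 s (k+1) = fun b1 b2 =>
    Q2 s k b1 b2
      + (if s = st k then β (((Finset.range k).filter fun k' => st k' = s).card) else 0)
        * (r2 s b1 b2
          + γ * ∑ s', (Finset.univ.sup' Finset.univ_nonempty fun c2 =>
              ∑ b1', π1 s' k b1' * Q2 s' k b1' c2) * p s b1 b2 s'
          - Q2 s k b1 b2)

variable {S A1 A2 : Type} [Fintype S] [Fintype A1] [Fintype A2]
    [Nonempty S] [Nonempty A1] [Nonempty A2]
    [DecidableEq S] [DecidableEq A1] [DecidableEq A2]

/-- the largest absolute value of an entry of a matrix -/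
noncomputable def maxNorm (Q : A1 → A2 → ℝ) : ℝ :=
  Finset.univ.sup' Finset.univ_nonempty fun q : A1 × A2 => |Q q.1 q.2|

namespace MBFP

/-- the number of visits to state `s` before stage `k` -/
def cnt (G : MBFP S A1 A2) (s : S) (k : ℕ) : ℕ :=
  ((Finset.range k).filter fun k' => G.st k' = s).card

/-- player 1's estimate of its continuation payoff at state `s` -/
noncomputable def vhat1 (G : MBFP S A1 A2) (k : ℕ) (s : S) : ℝ :=
  Finset.univ.sup' Finset.univ_nonempty fun b1 => ∑ b2, G.Q1 s k b1 b2 * G.π2 s k b2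

/-- player 2's estimate of its continuation payoff at state `s` -/
noncomputable def vhat2 (G : MBFP S A1 A2) (k : ℕ) (s : S) : ℝ :=
  Finset.univ.sup' Finset.univ_nonempty fun b2 => ∑ b1, G.π1 s k b1 * G.Q2 s k b1 b2

/-- Assumption 1 of the paper -/
def Assumption1 (G : MBFP S A1 A2) : Prop :=
  (∀ s, Tendsto (fun k => G.cnt s k) atTop atTop) ∧
  Tendsto (fun n => ∑ c ∈ Finset.range n, G.α c) atTop atTop ∧
  Tendsto (fun n => ∑ c ∈ Finset.range n, G.β c) atTop atTop ∧
  Tendsto G.α atTop (𝓝 0) ∧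
  Tendsto G.β atTop (𝓝 0) ∧
  Tendsto (fun c => G.β c / G.α c) atTop (𝓝 0)

end MBFP

open MeasureTheory

/-- the ambient space `Δ(A1)-space × Δ(A2)-space × Q1-space × Q2-space` -/
abbrev GameSpace (A1 A2 : Type) : Type := (A1 → ℝ) × (A2 → ℝ) × (A1 → A2 → ℝ) × (A1 → A2 → ℝ)

/-- the vertex of the simplex corresponding to a pure action -/
def vert {A : Type} [DecidableEq A] (a : A) : A → ℝ := fun b => if b = a then 1 else 0

/-- best-response actions of player 1 against `q2` in the auxiliary game `Q` -/
def br1 (Q : A1 → A2 → ℝ) (q2 : A2 → ℝ) : Set A1 :=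
  {a | ∀ b, ∑ b2, Q b b2 * q2 b2 ≤ ∑ b2, Q a b2 * q2 b2}

/-- best-response actions of player 2 against `q1` in the auxiliary game `Q` -/
def br2 (Q : A1 → A2 → ℝ) (q1 : A1 → ℝ) : Set A2 :=
  {a | ∀ b, ∑ b1, q1 b1 * Q b1 b ≤ ∑ b1, q1 b1 * Q b1 a}

/-- the set-valued map `F` of the best-response differential inclusion -/
def Fbr (x : GameSpace A1 A2) : Set (GameSpace A1 A2) :=
  convexHull ℝ {y | ∃ a1 ∈ br1 x.2.2.1 x.2.1, ∃ a2 ∈ br2 x.2.2.2 x.1,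
    y = (vert a1 - x.1, vert a2 - x.2.1, 0, 0)}

/-- the compact domain `X = Δ(A1) × Δ(A2) × D1 × D2` -/
noncomputable def Xset (γ : ℝ) (R1 R2 : S → A1 → A2 → ℝ) : Set (GameSpace A1 A2) :=
  {x | x.1 ∈ stdSimplex ℝ A1 ∧ x.2.1 ∈ stdSimplex ℝ A2 ∧
    maxNorm x.2.2.1 ≤ (1 / (1 - γ)) * (Finset.univ.sup' Finset.univ_nonempty
      fun s => maxNorm (R1 s)) ∧
    maxNorm x.2.2.2 ≤ (1 / (1 - γ)) * (Finset.univ.sup' Finset.univ_nonempty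
      fun s => maxNorm (R2 s))}

/-- the `δ`-thickening `F^δ` of a set-valued map -/
def FDel {E : Type} [NormedAddCommGroup E] (F : E → Set E) (δ : ℝ) (x : E) : Set E :=
  {w | ∃ z, ‖z - x‖ < δ ∧ ∃ u ∈ F z, ‖w - u‖ < δ}

section Interpolation

variable {E : Type} [NormedAddCommGroup E] [NormedSpace ℝ E]

/-- Every nonnegative time lies in a half-open interval between consecutive nodes, and the index
of that interval tends to infinity with time. -/
lemma exists_node_index {t : ℕ → ℝ} (h0 : t 0 = 0) (hmono : StrictMono t)
    (htop : Tendsto t atTop atTop) :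
    ∃ N : ℝ → ℕ, Tendsto N atTop atTop ∧
      ∀ τ, 0 ≤ τ → t (N τ) ≤ τ ∧ τ < t (N τ + 1) := by
  have hex : ∀ τ : ℝ, ∃ n, 0 ≤ τ → t n ≤ τ ∧ τ < t (n + 1) := by
    intro τ
    have hlt : ∃ n, τ < t n := (htop.eventually_gt_atTop τ).exists
    rcases hm : Nat.find hlt with _ | m
    · refine ⟨0, fun hτ => absurd (Nat.find_spec hlt) ?_⟩
      rw [hm, h0]
      exact hτ.not_gt
    · refine ⟨m, fun _ => ⟨?_, hm ▸ Nat.find_spec hlt⟩⟩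
      exact not_lt.1 (Nat.find_min hlt (by omega))
  choose N hN using hex
  refine ⟨N, tendsto_atTop.2 fun m => ?_, hN⟩
  filter_upwards [eventually_ge_atTop (t m), eventually_ge_atTop 0] with τ hm hτ
  have := hmono.lt_iff_lt.1 (hm.trans_lt (hN τ hτ).2)
  omega

/-- Every time in a mesh interval is the affine combination of its endpoints with weight
`(τ - a) / c`, where `c` is the length of the interval. -/
lemma affine_weight_mem_Icc {a b c τ : ℝ} (hc : 0 < c) (hb : b = a + c) (hτ : τ ∈ Set.Icc a b) :
    (τ - a) / c ∈ Set.Icc (0 : ℝ) 1 ∧ (1 - (τ - a) / c) * a + (τ - a) / c * b = τ := by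
  refine ⟨⟨div_nonneg (sub_nonneg.2 hτ.1) hc.le, (div_le_one hc).2 ?_⟩, ?_⟩
  · linarith [hτ.2]
  · rw [hb]
    field_simp
    ring

/-- On a mesh interval the interpolation is affine, with the given velocity. -/
lemma interpolation_eq {x : ℕ → E} {t α : ℕ → ℝ} {d : ℕ → E} {w : ℝ → E}
    (hα : ∀ n, 0 < α n) (ht : ∀ n, t (n + 1) = t n + α n)
    (hstep : ∀ n, x (n + 1) = x n + α n • d n)
    (hw : ∀ n, ∀ ξ ∈ Set.Icc (0 : ℝ) 1,
      w ((1 - ξ) * t n + ξ * t (n + 1)) = (1 - ξ) • x n + ξ • x (n + 1))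
    (n : ℕ) {τ : ℝ} (hτ : τ ∈ Set.Icc (t n) (t (n + 1))) :
    w τ = x n + (τ - t n) • d n := by
  have hpos := hα n
  obtain ⟨hξ, hτ'⟩ := affine_weight_mem_Icc hpos (ht n) hτ
  have key := hw n _ hξ
  rw [hτ', hstep, smul_add, smul_smul, div_mul_cancel₀ _ hpos.ne'] at key
  rw [key, sub_smul, one_smul]
  abel

/-- The interpolation of a process lying in a convex set stays in that set. -/
lemma interpolation_mem {X : Set E} (hX : Convex ℝ X) {x : ℕ → E} {t α : ℕ → ℝ} {w : ℝ → E}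
    (hxX : ∀ n, x n ∈ X)
    (hα : ∀ n, 0 < α n) (h0 : t 0 = 0) (ht : ∀ n, t (n + 1) = t n + α n)
    (htop : Tendsto t atTop atTop)
    (hw : ∀ n, ∀ ξ ∈ Set.Icc (0 : ℝ) 1,
      w ((1 - ξ) * t n + ξ * t (n + 1)) = (1 - ξ) • x n + ξ • x (n + 1))
    {τ : ℝ} (hτ : 0 ≤ τ) : w τ ∈ X := by
  have hmono : StrictMono t := strictMono_nat_of_lt_succ fun n => by linarith [ht n, hα n]
  obtain ⟨N, -, hN⟩ := exists_node_index h0 hmono htop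
  obtain ⟨hl, hr⟩ := hN τ hτ
  obtain ⟨hξ, hτ'⟩ := affine_weight_mem_Icc (hα (N τ)) (ht (N τ)) ⟨hl, hr.le⟩
  rw [← hτ', hw _ _ hξ]
  exact hX (hxX _) (hxX _) (sub_nonneg.2 hξ.2) hξ.1 (by ring)

/-- The interpolation of a process whose velocities are, up to a vanishing error, bounded
selections of `F` at the nodes is a perturbed solution of `dx/dt ∈ F(x)`. -/
lemma interpolation_perturbed {F : E → Set E} {x : ℕ → E} {t α : ℕ → ℝ} {u e : ℕ → E}
    {w : ℝ → E} {M : ℝ}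
    (hα : ∀ n, 0 < α n) (hα0 : Tendsto α atTop (𝓝 0))
    (h0 : t 0 = 0) (ht : ∀ n, t (n + 1) = t n + α n) (htop : Tendsto t atTop atTop)
    (hstep : ∀ n, x (n + 1) = x n + α n • (u n + e n))
    (hu : ∀ n, u n ∈ F (x n)) (huM : ∀ n, ‖u n‖ ≤ M) (he : Tendsto e atTop (𝓝 0))
    (hw : ∀ n, ∀ ξ ∈ Set.Icc (0 : ℝ) 1,
      w ((1 - ξ) * t n + ξ * t (n + 1)) = (1 - ξ) • x n + ξ • x (n + 1)) :
    ∃ δ : ℝ → ℝ, (∀ τ, 0 ≤ δ τ) ∧ Tendsto δ atTop (𝓝 0) ∧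
      ∀ᵐ τ ∂(volume.restrict (Set.Ici (0 : ℝ))),
        ∃ d : E, HasDerivAt w d τ ∧ d ∈ FDel F (δ τ) (w τ) := by
  have hmono : StrictMono t := strictMono_nat_of_lt_succ fun n => by linarith [ht n, hα n]
  obtain ⟨N, hNtop, hN⟩ := exists_node_index h0 hmono htop
  have hM : 0 ≤ M := (norm_nonneg _).trans (huM 0)
  set ε : ℕ → ℝ := fun n => α n * (M + ‖e n‖) + ‖e n‖ + α n with hε
  have hε0 : Tendsto ε atTop (𝓝 0) := by
    have he' : Tendsto (fun n => ‖e n‖) atTop (𝓝 0) := by simpa using he.norm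
    simpa using ((hα0.mul (he'.const_add M)).add he').add hα0
  refine ⟨fun τ => ε (N τ), fun τ => ?_, hε0.comp hNtop, ?_⟩
  · have := (hα (N τ)).le
    positivity
  rw [ae_restrict_iff' measurableSet_Ici]
  filter_upwards [(Set.countable_range t).ae_notMem volume] with τ hτt hτ
  obtain ⟨hl, hr⟩ := hN τ hτ
  set n := N τ
  have hl' : t n < τ := hl.lt_of_ne fun h => hτt ⟨n, h⟩
  have hpos := hα n
  have hen := norm_nonneg (e n)
  have hdist : ‖(τ - t n) • (u n + e n)‖ ≤ α n * (M + ‖e n‖) := by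
    rw [norm_smul, Real.norm_of_nonneg (sub_nonneg.2 hl)]
    have : ‖u n + e n‖ ≤ M + ‖e n‖ := (norm_add_le _ _).trans (by linarith [huM n])
    have hle : τ - t n ≤ α n := by linarith [ht n]
    gcongr
  refine ⟨u n + e n, ?_, x n, ?_, u n, hu n, ?_⟩
  · have hd : HasDerivAt (fun τ => x n + (τ - t n) • (u n + e n)) (u n + e n) τ := by
      simpa using (((hasDerivAt_id τ).sub_const (t n)).smul_const (u n + e n)).const_add (x n)
    refine hd.congr_of_eventuallyEq ?_
    filter_upwards [Icc_mem_nhds hl' hr] with τ' hτ'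
    exact interpolation_eq hα ht hstep hw n hτ'
  · rw [interpolation_eq hα ht hstep hw n ⟨hl, hr.le⟩, sub_add_cancel_left, norm_neg]
    simp only [hε]
    linarith
  · rw [add_sub_cancel_left]
    simp only [hε]
    have : 0 ≤ α n * (M + ‖e n‖) := by positivity
    linarith

end Interpolation

section Bounds

lemma abs_sum_mul_le_of_mem_stdSimplex {ι : Type*} [Fintype ι] {f q : ι → ℝ} {C : ℝ}
    (hq : q ∈ stdSimplex ℝ ι) (hf : ∀ i, |f i| ≤ C) : |∑ i, f i * q i| ≤ C := by
  calc |∑ i, f i * q i| ≤ ∑ i, |f i * q i| := Finset.abs_sum_le_sum_abs _ _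
    _ ≤ ∑ i, C * q i := Finset.sum_le_sum fun i _ => by
        rw [abs_mul, abs_of_nonneg (hq.1 i)]
        exact mul_le_mul_of_nonneg_right (hf i) (hq.1 i)
    _ = C := by rw [← Finset.mul_sum, hq.2, mul_one]

lemma abs_sup'_le {ι : Type*} [Fintype ι] [Nonempty ι] {f : ι → ℝ} {C : ℝ}
    (hf : ∀ i, |f i| ≤ C) : |Finset.univ.sup' Finset.univ_nonempty f| ≤ C := by
  obtain ⟨i, -, hi⟩ := Finset.exists_mem_eq_sup' Finset.univ_nonempty f
  rw [hi]
  exact hf i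

lemma abs_discounted_le {ι : Type*} [Fintype ι] {v q : ι → ℝ} {r γ M : ℝ}
    (hγ0 : 0 ≤ γ) (hγ1 : γ < 1) (hq : q ∈ stdSimplex ℝ ι) (hr : |r| ≤ M)
    (hv : ∀ i, |v i| ≤ 1 / (1 - γ) * M) : |r + γ * ∑ i, v i * q i| ≤ 1 / (1 - γ) * M := by
  have h1 : 0 < 1 - γ := sub_pos.2 hγ1
  calc |r + γ * ∑ i, v i * q i| ≤ |r| + |γ * ∑ i, v i * q i| := abs_add_le _ _
    _ ≤ M + γ * (1 / (1 - γ) * M) := by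
        rw [abs_mul, abs_of_nonneg hγ0]
        gcongr
        exact abs_sum_mul_le_of_mem_stdSimplex hq hv
    _ = 1 / (1 - γ) * M := by
        field_simp
        ring

lemma abs_relaxation_le {x y b C : ℝ} (hb0 : 0 ≤ b) (hb1 : b ≤ 1) (hx : |x| ≤ C)
    (hy : |y| ≤ C) : |x + b * (y - x)| ≤ C := by
  rw [abs_le] at *
  constructor <;> nlinarith

lemma abs_le_one_of_mem_stdSimplex {ι : Type*} [Fintype ι] {q : ι → ℝ}
    (hq : q ∈ stdSimplex ℝ ι) (i : ι) : |q i| ≤ 1 := by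
  rw [abs_of_nonneg (hq.1 i), ← hq.2]
  exact Finset.single_le_sum (fun j _ => hq.1 j) (Finset.mem_univ i)

lemma norm_vert_sub_le {A : Type} [Fintype A] [DecidableEq A] (a : A) {q : A → ℝ}
    (hq : q ∈ stdSimplex ℝ A) : ‖vert a - q‖ ≤ 1 := by
  refine (pi_norm_le_iff_of_nonneg zero_le_one).2 fun b => ?_
  have h0 := hq.1 b
  have h1 := (abs_le.1 (abs_le_one_of_mem_stdSimplex hq b)).2
  rw [Pi.sub_apply, Real.norm_eq_abs, abs_le, vert]
  split_ifs <;> constructor <;> linarith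

end Bounds

section MaxNorm

variable {A B : Type} [Fintype A] [Fintype B] [Nonempty A] [Nonempty B]

lemma maxNorm_le_iff {Q : A → B → ℝ} {C : ℝ} : maxNorm Q ≤ C ↔ ∀ a b, |Q a b| ≤ C := by
  simp [maxNorm, Finset.sup'_le_iff]

lemma convex_maxNorm_le (C : ℝ) : Convex ℝ {Q : A → B → ℝ | maxNorm Q ≤ C} := by
  intro Q hQ Q' hQ' a b ha hb hab
  simp only [Set.mem_ofPred_eq, maxNorm_le_iff] at hQ hQ' ⊢
  intro i j
  have hb' : b = 1 - a := by linarith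
  have := abs_relaxation_le hb (by linarith) (hQ i j) (hQ' i j)
  simp only [Pi.add_apply, Pi.smul_apply, smul_eq_mul]
  rw [show a = 1 - b by linarith]
  convert this using 2
  ring

lemma norm_sub_le_of_maxNorm_le {Q Q' : A → B → ℝ} {C : ℝ} (hQ : maxNorm Q ≤ C)
    (hQ' : maxNorm Q' ≤ C) : ‖Q - Q'‖ ≤ 2 * C := by
  rw [maxNorm_le_iff] at hQ hQ'
  have hC : 0 ≤ C := (abs_nonneg _).trans (hQ (Classical.arbitrary A) (Classical.arbitrary B))
  refine (pi_norm_le_iff_of_nonneg (by linarith)).2 fun a =>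
    (pi_norm_le_iff_of_nonneg (by linarith)).2 fun b => ?_
  calc ‖(Q - Q') a b‖ ≤ |Q a b| + |Q' a b| := abs_sub _ _
    _ ≤ 2 * C := by linarith [hQ a b, hQ' a b]

variable {T : Type} [Fintype T] [Nonempty T]

lemma abs_payoff_le (R : T → A → B → ℝ) (s : T) (a : A) (b : B) :
    |R s a b| ≤ Finset.univ.sup' Finset.univ_nonempty fun s => maxNorm (R s) :=
  (maxNorm_le_iff.1 le_rfl a b).trans
    (Finset.le_sup' (fun s => maxNorm (R s)) (Finset.mem_univ s))

lemma convex_Xset (γ : ℝ) (R1 R2 : T → A → B → ℝ) : Convex ℝ (Xset γ R1 R2) :=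
  (convex_stdSimplex ℝ A).prod ((convex_stdSimplex ℝ B).prod
    ((convex_maxNorm_le _).prod (convex_maxNorm_le _)))

end MaxNorm

namespace MBFP

variable (G : MBFP S A1 A2)

/-- the beliefs about state `s` held at stage `k` -/
def belief (s : S) (k : ℕ) : GameSpace A1 A2 := (G.π1 s k, G.π2 s k, G.Q1 s k, G.Q2 s k)

/-- the value towards which player 1's Q-belief at state `s` moves at stage `k` -/
noncomputable def target1 (s : S) (k : ℕ) : A1 → A2 → ℝ := fun b1 b2 =>
  G.r1 s b1 b2 + G.γ * ∑ s', G.vhat1 k s' * G.p s b1 b2 s'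

/-- the value towards which player 2's Q-belief at state `s` moves at stage `k` -/
noncomputable def target2 (s : S) (k : ℕ) : A1 → A2 → ℝ := fun b1 b2 =>
  G.r2 s b1 b2 + G.γ * ∑ s', G.vhat2 k s' * G.p s b1 b2 s'

/-- the radius of the domain of Q-functions for the stage payoffs `R` -/
noncomputable def radius (R : S → A1 → A2 → ℝ) : ℝ :=
  1 / (1 - G.γ) * Finset.univ.sup' Finset.univ_nonempty fun s => maxNorm (R s)

lemma mem_stdSimplex_p (s : S) (a : A1) (b : A2) : G.p s a b ∈ stdSimplex ℝ S :=
  ⟨G.p_nonneg s a b, G.p_sum_one s a b⟩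

lemma maxNorm_payoff_le_radius (R : S → A1 → A2 → ℝ) (s : S) : maxNorm (R s) ≤ G.radius R := by
  refine maxNorm_le_iff.2 fun a b => (abs_payoff_le R s a b).trans ?_
  have h0 := (abs_nonneg _).trans (abs_payoff_le R s a b)
  have h1 : 0 < 1 - G.γ := sub_pos.2 G.γ_lt_one
  exact le_mul_of_one_le_left h0 ((one_le_div h1).2 (by linarith [G.γ_nonneg]))

lemma maxNorm_target1_le {k : ℕ} (hQ : ∀ s, maxNorm (G.Q1 s k) ≤ G.radius G.r1) (s : S) :
    maxNorm (G.target1 s k) ≤ G.radius G.r1 :=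
  maxNorm_le_iff.2 fun a b => abs_discounted_le G.γ_nonneg G.γ_lt_one
    (G.mem_stdSimplex_p s a b) (abs_payoff_le G.r1 s a b) fun s' => abs_sup'_le fun c =>
      abs_sum_mul_le_of_mem_stdSimplex (G.π2_simplex s' k) (maxNorm_le_iff.1 (hQ s') c)

lemma maxNorm_target2_le {k : ℕ} (hQ : ∀ s, maxNorm (G.Q2 s k) ≤ G.radius G.r2) (s : S) :
    maxNorm (G.target2 s k) ≤ G.radius G.r2 :=
  maxNorm_le_iff.2 fun a b => abs_discounted_le G.γ_nonneg G.γ_lt_one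
    (G.mem_stdSimplex_p s a b) (abs_payoff_le G.r2 s a b) fun s' => abs_sup'_le fun c => by
      simp_rw [mul_comm (G.π1 s' k _)]
      exact abs_sum_mul_le_of_mem_stdSimplex (G.π1_simplex s' k)
        fun b1 => maxNorm_le_iff.1 (hQ s') b1 c

lemma step_mem_Icc (s : S) (k : ℕ) :
    (if s = G.st k then G.β (G.cnt s k) else 0) ∈ Set.Icc (0 : ℝ) 1 := by
  split_ifs
  · exact ⟨(G.β_mem _).1.le, (G.β_mem _).2⟩
  · simp

lemma maxNorm_Q1_le (k : ℕ) : ∀ s, maxNorm (G.Q1 s k) ≤ G.radius G.r1 := by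
  induction k with
  | zero => exact fun s => by rw [G.Q1_init]; exact G.maxNorm_payoff_le_radius _ s
  | succ k ih =>
    intro s
    rw [G.Q1_upd, maxNorm_le_iff]
    exact fun a b => abs_relaxation_le (G.step_mem_Icc s k).1 (G.step_mem_Icc s k).2
      (maxNorm_le_iff.1 (ih s) a b) (maxNorm_le_iff.1 (G.maxNorm_target1_le ih s) a b)

lemma maxNorm_Q2_le (k : ℕ) : ∀ s, maxNorm (G.Q2 s k) ≤ G.radius G.r2 := by
  induction k with
  | zero => exact fun s => by rw [G.Q2_init]; exact G.maxNorm_payoff_le_radius _ s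
  | succ k ih =>
    intro s
    rw [G.Q2_upd, maxNorm_le_iff]
    exact fun a b => abs_relaxation_le (G.step_mem_Icc s k).1 (G.step_mem_Icc s k).2
      (maxNorm_le_iff.1 (ih s) a b) (maxNorm_le_iff.1 (G.maxNorm_target2_le ih s) a b)

lemma belief_mem_Xset (s : S) (k : ℕ) : G.belief s k ∈ Xset G.γ G.r1 G.r2 :=
  ⟨G.π1_simplex s k, G.π2_simplex s k, G.maxNorm_Q1_le k s, G.maxNorm_Q2_le k s⟩

lemma belief_succ_of_ne {s : S} {k : ℕ} (hs : G.st k ≠ s) :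
    G.belief s (k + 1) = G.belief s k := by
  simp [belief, G.π1_upd s k, G.π2_upd s k, G.Q1_upd s k, G.Q2_upd s k, hs.symm]

/-- the selection of the best-response field used at a visit to `s` in stage `k` -/
def drift (s : S) (k : ℕ) : GameSpace A1 A2 :=
  (vert (G.astar1 k) - G.π1 s k, vert (G.astar2 k) - G.π2 s k, 0, 0)

/-- the unscaled displacement of the Q-beliefs at a visit to `s` in stage `k` -/
noncomputable def qDrift (s : S) (k : ℕ) : GameSpace A1 A2 :=
  (0, 0, G.target1 s k - G.Q1 s k, G.target2 s k - G.Q2 s k)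

lemma drift_mem {s : S} {k : ℕ} (hs : G.st k = s) : G.drift s k ∈ Fbr (G.belief s k) := by
  subst hs
  exact subset_convexHull ℝ _ ⟨_, G.astar1_br k, _, G.astar2_br k, rfl⟩

lemma norm_drift_le (s : S) (k : ℕ) : ‖G.drift s k‖ ≤ 1 := by
  simp [drift, Prod.norm_def, norm_vert_sub_le, G.π1_simplex s k, G.π2_simplex s k]

lemma norm_qDrift_le (s : S) (k : ℕ) :
    ‖G.qDrift s k‖ ≤ max (2 * G.radius G.r1) (2 * G.radius G.r2) := by
  have h1 := norm_sub_le_of_maxNorm_le (G.maxNorm_target1_le (G.maxNorm_Q1_le k) s)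
    (G.maxNorm_Q1_le k s)
  have h2 := norm_sub_le_of_maxNorm_le (G.maxNorm_target2_le (G.maxNorm_Q2_le k) s)
    (G.maxNorm_Q2_le k s)
  have h3 := (norm_nonneg _).trans h1
  simp only [qDrift, Prod.norm_def, norm_zero]
  exact max_le (le_max_of_le_left h3) (max_le (le_max_of_le_left h3) (max_le_max h1 h2))

lemma belief_succ {s : S} {k : ℕ} (hs : G.st k = s) :
    G.belief s (k + 1) = G.belief s k + G.α (G.cnt s k) •
      (G.drift s k + (G.β (G.cnt s k) / G.α (G.cnt s k)) • G.qDrift s k) := by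
  have hα := (G.α_mem (G.cnt s k)).1.ne'
  have hcnt : ((Finset.range k).filter fun k' => G.st k' = s).card = G.cnt s k := rfl
  rw [smul_add, smul_smul, mul_div_cancel₀ _ hα]
  refine Prod.ext ?_ (Prod.ext ?_ (Prod.ext ?_ ?_))
  · ext b
    simp [belief, drift, qDrift, G.π1_upd s k, hs, hcnt, vert]
  · ext b
    simp [belief, drift, qDrift, G.π2_upd s k, hs, hcnt, vert]
  · ext a b
    simp [belief, drift, qDrift, G.Q1_upd s k, hs, hcnt, target1, vhat1]
  · ext a b
    simp [belief, drift, qDrift, G.Q2_upd s k, hs, hcnt, target2, vhat2]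

lemma cnt_succ (s : S) (k : ℕ) :
    G.cnt s (k + 1) = G.cnt s k + if G.st k = s then 1 else 0 := by
  unfold cnt
  rw [Finset.range_add_one, Finset.filter_insert]
  split_ifs <;> simp

lemma cnt_mono (s : S) : Monotone (G.cnt s) :=
  monotone_nat_of_le_succ fun k => by rw [G.cnt_succ]; exact Nat.le_add_right _ _

lemma belief_eq_of_cnt_eq {s : S} {k m : ℕ} (hkm : k ≤ m) (h : G.cnt s m = G.cnt s k) :
    G.belief s m = G.belief s k := by
  induction m, hkm using Nat.le_induction with
  | base => rfl
  | succ m hkm ih =>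
    have h1 := G.cnt_mono s hkm
    have h2 := G.cnt_succ s m
    split_ifs at h2 with hs
    · omega
    · rw [G.belief_succ_of_ne hs, ih (by omega)]

/-- Between the first stages with `n` and `n + 1` earlier visits to `s`, the beliefs at `s` are
updated exactly once, at the last stage before the latter. -/
lemma exists_visit {s : S} {kn : ℕ → ℕ}
    (hkn : ∀ n, G.cnt s (kn n) = n ∧ ∀ k, G.cnt s k = n → kn n ≤ k) (n : ℕ) :
    ∃ m, kn (n + 1) = m + 1 ∧ G.st m = s ∧ G.cnt s m = n ∧
      G.belief s m = G.belief s (kn n) := by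
  obtain ⟨hc, hmin⟩ := hkn (n + 1)
  rcases hm : kn (n + 1) with _ | m
  · rw [hm] at hc
    simp [cnt] at hc
  rw [hm, G.cnt_succ] at hc
  have hs : G.st m = s := by
    by_contra hs
    rw [if_neg hs] at hc
    have := hmin m hc
    omega
  rw [if_pos hs] at hc
  have hc' : G.cnt s m = n := by omega
  exact ⟨m, rfl, hs, hc', G.belief_eq_of_cnt_eq ((hkn n).2 m hc') (hc'.trans (hkn n).1.symm)⟩

end MBFP

/-- Lemma 3 of Sayin–Parise–Ozdaglar: for any state `s`, the piecewise affine
interpolation of the discrete-time process `(x_{s,n})_n` is a bounded perturbed solution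
of the differential inclusion `dx/dt ∈ F(x)`. -/
theorem interpolation_is_perturbed_solution (G : MBFP S A1 A2) (h : G.Assumption1) (s : S)
    (kn : ℕ → ℕ)
    (hkn : ∀ n, G.cnt s (kn n) = n ∧ ∀ k, G.cnt s k = n → kn n ≤ k)
    (xseq : ℕ → GameSpace A1 A2)
    (hx : ∀ n, xseq n = (G.π1 s (kn n), G.π2 s (kn n), G.Q1 s (kn n), G.Q2 s (kn n)))
    (tseq : ℕ → ℝ) (ht : ∀ n, tseq n = ∑ ι ∈ Finset.range n, G.α ι)
    (w : ℝ → GameSpace A1 A2)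
    (hwnode : ∀ n, w (tseq n) = xseq n)
    (hwaff : ∀ n, ∀ ξ ∈ Set.Icc (0:ℝ) 1,
      w ((1 - ξ) * tseq n + ξ * tseq (n+1)) = (1 - ξ) • xseq n + ξ • xseq (n+1)) :
    (∀ t : ℝ, 0 ≤ t → w t ∈ Xset G.γ G.r1 G.r2) ∧
    ∃ δ : ℝ → ℝ, (∀ t, 0 ≤ δ t) ∧ Tendsto δ atTop (𝓝 0) ∧
      ∀ᵐ τ ∂(volume.restrict (Set.Ici (0:ℝ))),
        ∃ d : GameSpace A1 A2, HasDerivAt w d τ ∧ d ∈ FDel Fbr (δ τ) (w τ) := by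
  obtain ⟨-, hαsum, -, hα0, -, hratio⟩ := h
  have hαpos : ∀ n, 0 < G.α n := fun n => (G.α_mem n).1
  have hxb : ∀ n, xseq n = G.belief s (kn n) := hx
  have h0 : tseq 0 = 0 := by simp [ht]
  have hts : ∀ n, tseq (n + 1) = tseq n + G.α n := fun n => by
    rw [ht, ht, Finset.sum_range_succ]
  have htop : Tendsto tseq atTop atTop := hαsum.congr fun n => (ht n).symm
  choose m hm hms hmc hmb using G.exists_visit hkn
  refine ⟨fun t h0t => interpolation_mem (convex_Xset _ _ _)
    (fun n => (hxb n).symm ▸ G.belief_mem_Xset s _) hαpos h0 hts htop hwaff h0t, ?_⟩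
  refine interpolation_perturbed (u := fun n => G.drift s (m n))
    (e := fun n => (G.β n / G.α n) • G.qDrift s (m n)) hαpos hα0 h0 hts htop
    (fun n => ?_) (fun n => ?_) (fun n => G.norm_drift_le s (m n)) ?_ hwaff
  · rw [hxb, hxb, hm, G.belief_succ (hms n), hmc, hmb]
  · rw [hxb, ← hmb]
    exact G.drift_mem (hms n)
  · refine hratio.zero_smul_isBoundedUnder_le ?_
    exact isBoundedUnder_of ⟨_, fun n => G.norm_qDrift_le s (m n)⟩
end

section
/- The function V is a Lyapunov function for the continuous-time best-response dynamics: for every solution (π1(·), π2(·)) of the best-response differential inclusion and all 0 ≤ t < t', one has V(π1(t'), π2(t')) ≤ V(π1(t), π2(t)), and equality holds if and only if V(π1(t), π2(t)) = 0. -/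
open Finset Filter Topology MeasureTheory

variable {A1 A2 : Type} [Fintype A1] [Fintype A2] [Nonempty A1] [Nonempty A2]
  [DecidableEq A1] [DecidableEq A2]

/-- `h₁(π₂) = max_{a1∈A1} a1ᵀ Q̃₁ π₂` -/
noncomputable def h1 (Qt1 : A1 → A2 → ℝ) (q2 : A2 → ℝ) : ℝ :=
  Finset.univ.sup' Finset.univ_nonempty fun b1 => ∑ b2, Qt1 b1 b2 * q2 b2

/-- `h₂(π₁) = max_{a2∈A2} π₁ᵀ Q̃₂ a2` -/
noncomputable def h2 (Qt2 : A1 → A2 → ℝ) (q1 : A1 → ℝ) : ℝ :=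
  Finset.univ.sup' Finset.univ_nonempty fun b2 => ∑ b1, q1 b1 * Qt2 b1 b2

/-- the candidate Lyapunov function `V(π₁,π₂) = (h₁(π₂) + h₂(π₁) − λ‖Q̃₁+Q̃₂‖_max)₊` -/
noncomputable def Vlyap (Qt1 Qt2 : A1 → A2 → ℝ) (l : ℝ) (q1 : A1 → ℝ) (q2 : A2 → ℝ) : ℝ :=
  max (h1 Qt1 q2 + h2 Qt2 q1 - l * maxNorm fun b1 b2 => Qt1 b1 b2 + Qt2 b1 b2) 0

/-- `h1` is Lipschitz in the mixed strategy, being a maximum of linear forms. -/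
lemma exists_lipschitzWith_h1 {A B : Type} [Fintype A] [Fintype B] [Nonempty A]
    (Q : A → B → ℝ) : ∃ K, LipschitzWith K (h1 Q) := by
  refine ⟨_, LipschitzWith.of_le_add_mul' (∑ a, ∑ b, |Q a b|) fun x y => ?_⟩
  refine Finset.sup'_le _ _ fun a _ => ?_
  have hle : ∑ b, Q a b * y b ≤ h1 Q y :=
    Finset.le_sup' (fun a => ∑ b, Q a b * y b) (Finset.mem_univ a)
  have hdiff : ∑ b, Q a b * x b - ∑ b, Q a b * y b ≤ (∑ b, |Q a b|) * dist x y := by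
    rw [← Finset.sum_sub_distrib, Finset.sum_mul]
    refine Finset.sum_le_sum fun b _ => ?_
    rw [← mul_sub]
    refine (le_abs_self _).trans ?_
    rw [abs_mul]
    gcongr
    rw [← Real.dist_eq]
    exact dist_le_pi_dist x y b
  have hrow : ∑ b, |Q a b| ≤ ∑ a, ∑ b, |Q a b| :=
    Finset.single_le_sum (f := fun a => ∑ b, |Q a b|)
      (fun a _ => Finset.sum_nonneg fun b _ => abs_nonneg _) (Finset.mem_univ a)
  have := mul_le_mul_of_nonneg_right hrow (dist_nonneg (x := x) (y := y))
  linarith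

/-- Value of `h1` at a maximizing row. -/
lemma h1_eq_of_forall_le {A B : Type} [Fintype A] [Fintype B] [Nonempty A]
    {Q : A → B → ℝ} {x : B → ℝ} {a : A}
    (ha : ∀ c, ∑ b, Q c b * x b ≤ ∑ b, Q a b * x b) : h1 Q x = ∑ b, Q a b * x b :=
  le_antisymm (Finset.sup'_le _ _ fun c _ => ha c)
    (Finset.le_sup' (fun a => ∑ b, Q a b * x b) (Finset.mem_univ a))

/-- Envelope theorem: wherever `h1` is differentiable along a differentiable curve, its derivative
is that of the linear form given by any maximizing row. -/
lemma hasDerivAt_h1_comp {A B : Type} [Fintype A] [Fintype B] [Nonempty A]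
    {Q : A → B → ℝ} {p : ℝ → B → ℝ} {v : B → ℝ} {t : ℝ} {a : A}
    (hp : HasDerivAt p v t) (hd : DifferentiableAt ℝ (fun s => h1 Q (p s)) t)
    (ha : ∀ c, ∑ b, Q c b * p t b ≤ ∑ b, Q a b * p t b) :
    HasDerivAt (fun s => h1 Q (p s)) (∑ b, Q a b * v b) t := by
  have hlin : HasDerivAt (fun s => ∑ b, Q a b * p s b) (∑ b, Q a b * v b) t :=
    HasDerivAt.fun_sum fun b _ => (hasDerivAt_pi.1 hp b).const_mul _
  have hmin : IsLocalMin (fun s => h1 Q (p s) - ∑ b, Q a b * p s b) t := by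
    refine Filter.Eventually.of_forall fun s => ?_
    have hs : ∑ b, Q a b * p s b ≤ h1 Q (p s) :=
      Finset.le_sup' (fun a => ∑ b, Q a b * p s b) (Finset.mem_univ a)
    simp only [h1_eq_of_forall_le ha]
    linarith
  have hzero := hmin.hasDerivAt_eq_zero (hd.hasDerivAt.sub hlin)
  rw [← sub_eq_zero.1 hzero]
  exact hd.hasDerivAt

lemma vert_mem_stdSimplex {B : Type} [Fintype B] [DecidableEq B] (b : B) :
    vert b ∈ stdSimplex ℝ B :=
  ⟨fun c => by unfold vert; split_ifs <;> norm_num, by simp [vert]⟩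

lemma norm_sub_le_one_of_mem_stdSimplex {B : Type} [Fintype B] {x y : B → ℝ}
    (hx : x ∈ stdSimplex ℝ B) (hy : y ∈ stdSimplex ℝ B) : ‖x - y‖ ≤ 1 := by
  refine (pi_norm_le_iff_of_nonneg zero_le_one).2 fun b => ?_
  have h1x := mem_Icc_of_mem_stdSimplex hx b
  have h1y := mem_Icc_of_mem_stdSimplex hy b
  rw [Pi.sub_apply, Real.norm_eq_abs, abs_le]
  constructor <;> linarith [h1x.1, h1x.2, h1y.1, h1y.2]

section Primitive

variable {E : Type*} [NormedAddCommGroup E] [NormedSpace ℝ E] {p f : ℝ → E}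

/-- A primitive of an almost everywhere bounded function is Lipschitz. -/
lemma lipschitzOnWith_of_eq_integral {K : NNReal}
    (hint : ∀ T : ℝ, IntegrableOn f (Set.Icc 0 T))
    (heq : ∀ t : ℝ, 0 ≤ t → p t = p 0 + ∫ τ in (0:ℝ)..t, f τ)
    (hf : ∀ᵐ t ∂(volume.restrict (Set.Ici (0:ℝ))), ‖f t‖ ≤ K) :
    LipschitzOnWith K p (Set.Ici 0) := by
  have hii : ∀ t, 0 ≤ t → IntervalIntegrable f volume 0 t := fun t ht =>
    (intervalIntegrable_iff_integrableOn_Icc_of_le ht).2 (hint t)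
  refine LipschitzOnWith.of_dist_le_mul fun x hx y hy => ?_
  rw [heq x hx, heq y hy, dist_add_left, dist_eq_norm,
    intervalIntegral.integral_interval_sub_left (hii x hx) (hii y hy), Real.dist_eq]
  refine intervalIntegral.norm_integral_le_of_norm_le_const_ae ?_
  filter_upwards [(ae_restrict_iff' measurableSet_Ici).1 hf] with t ht hmem
  exact ht ((le_min hy hx).trans hmem.1.le)

/-- A primitive is differentiable almost everywhere, by Lebesgue's theorem. -/
lemma ae_hasDerivAt_of_eq_integral [CompleteSpace E]
    (hint : ∀ T : ℝ, IntegrableOn f (Set.Icc 0 T))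
    (heq : ∀ t : ℝ, 0 ≤ t → p t = p 0 + ∫ τ in (0:ℝ)..t, f τ) {T : ℝ} (hT : 0 ≤ T) :
    ∀ᵐ t, t ∈ Set.Ioo 0 T → HasDerivAt p (f t) t := by
  have hii : IntervalIntegrable f volume 0 T :=
    (intervalIntegrable_iff_integrableOn_Icc_of_le hT).2 (hint T)
  filter_upwards [hii.ae_hasDerivAt_integral] with t ht hmem
  have hsub : t ∈ Set.uIcc 0 T := by
    rw [Set.uIcc_of_le hT]; exact Set.Ioo_subset_Icc_self hmem
  have hder := (ht hsub 0 Set.left_mem_uIcc).const_add (p 0)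
  refine hder.congr_of_eventuallyEq ?_
  filter_upwards [lt_mem_nhds hmem.1] with s hs
  exact heq s hs.le

end Primitive

/-- An absolutely continuous function with almost everywhere nonpositive derivative decreases. -/
lemma AbsolutelyContinuousOnInterval.le_of_ae_deriv_nonpos {F : ℝ → ℝ} {a b : ℝ} (hab : a ≤ b)
    (hF : AbsolutelyContinuousOnInterval F a b)
    (hd : ∀ᵐ t, t ∈ Set.Ioo a b → deriv F t ≤ 0) : F b ≤ F a := by
  have hle : ∫ t in a..b, deriv F t ≤ 0 := by
    rw [intervalIntegral.integral_of_le hab, integral_Ioc_eq_integral_Ioo]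
    exact integral_nonpos_of_ae ((ae_restrict_iff' measurableSet_Ioo).2 hd)
  rw [hF.integral_deriv_eq_sub] at hle
  linarith

/-- Along a best-response trajectory `p`, the best-response value `h1 Q (p t)` is absolutely
continuous, and its derivative is almost everywhere the change of the payoff of any best row. -/
lemma h1_along_trajectory {A B : Type} [Fintype A] [Fintype B] [Nonempty A] [DecidableEq B]
    (Q : A → B → ℝ) {p f : ℝ → B → ℝ}
    (hp : ∀ t : ℝ, 0 ≤ t → p t ∈ stdSimplex ℝ B)
    (hf : ∀ᵐ t ∂(volume.restrict (Set.Ici (0:ℝ))), ∃ b, f t = vert b)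
    (hint : ∀ T : ℝ, IntegrableOn (fun τ => f τ - p τ) (Set.Icc 0 T))
    (heq : ∀ t : ℝ, 0 ≤ t → p t = p 0 + ∫ τ in (0:ℝ)..t, (f τ - p τ))
    {s T : ℝ} (hs : 0 ≤ s) (hsT : s ≤ T) :
    AbsolutelyContinuousOnInterval (fun t => h1 Q (p t)) s T ∧
    ∀ᵐ t, t ∈ Set.Ioo s T → ∀ (a : A) (b : B),
      (∀ c, ∑ j, Q c j * p t j ≤ ∑ j, Q a j * p t j) → f t = vert b →
      HasDerivAt (fun t => h1 Q (p t)) (Q a b - h1 Q (p t)) t := by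
  obtain ⟨K, hK⟩ := exists_lipschitzWith_h1 Q
  have hlip : LipschitzOnWith 1 p (Set.Ici 0) := by
    refine lipschitzOnWith_of_eq_integral hint heq ?_
    filter_upwards [hf, ae_restrict_mem measurableSet_Ici] with t ⟨b, hb⟩ ht
    rw [hb]
    exact norm_sub_le_one_of_mem_stdSimplex (vert_mem_stdSimplex b) (hp t ht)
  have hcomp : AbsolutelyContinuousOnInterval (fun t => h1 Q (p t)) s T := by
    refine (hK.comp_lipschitzOnWith (hlip.mono ?_)).absolutelyContinuousOnInterval
    rw [Set.uIcc_of_le hsT]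
    exact fun t ht => hs.trans ht.1
  refine ⟨hcomp, ?_⟩
  filter_upwards [ae_hasDerivAt_of_eq_integral hint heq (hs.trans hsT), hcomp.ae_differentiableAt]
    with t ht hdiff hmem a b ha hb
  have hd : DifferentiableAt ℝ (fun t => h1 Q (p t)) t :=
    hdiff (by rw [Set.uIcc_of_le hsT]; exact Set.Ioo_subset_Icc_self hmem)
  convert! hasDerivAt_h1_comp (ht ⟨hs.trans_lt hmem.1, hmem.2⟩) hd ha using 1
  rw [h1_eq_of_forall_le ha, hb]
  simp [mul_sub, Finset.sum_sub_distrib, vert]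

lemma le_maxNorm {A B : Type} [Fintype A] [Fintype B] [Nonempty A] [Nonempty B]
    (Q : A → B → ℝ) (a : A) (b : B) : Q a b ≤ maxNorm Q :=
  (le_abs_self _).trans
    (Finset.le_sup' (fun q : A × B => |Q q.1 q.2|) (Finset.mem_univ (a, b)))

lemma maxNorm_nonneg {A B : Type} [Fintype A] [Fintype B] [Nonempty A] [Nonempty B]
    (Q : A → B → ℝ) : 0 ≤ maxNorm Q := by
  obtain ⟨⟨a, b⟩⟩ := (inferInstance : Nonempty (A × B))
  exact (abs_nonneg _).trans
    (Finset.le_sup' (fun q : A × B => |Q q.1 q.2|) (Finset.mem_univ (a, b)))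

lemma h2_eq_h1_swap {A B : Type} [Fintype A] [Fintype B] [Nonempty B]
    (Q : A → B → ℝ) (x : A → ℝ) : h2 Q x = h1 (fun b a => Q a b) x := by
  simp only [h1, h2, mul_comm]

/-- Lemma 4 of Sayin–Parise–Ozdaglar: `V` is a Lyapunov function for the continuous-time
best-response dynamics: along every solution it is nonincreasing, and constant on an
interval only where it vanishes. -/
theorem V_is_lyapunov (Qt1 Qt2 : A1 → A2 → ℝ) (l : ℝ) (hl : 1 < l)
    (π1 : ℝ → A1 → ℝ) (π2 : ℝ → A2 → ℝ) (a1f : ℝ → A1 → ℝ) (a2f : ℝ → A2 → ℝ)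
    (hπ1mem : ∀ t : ℝ, 0 ≤ t → π1 t ∈ stdSimplex ℝ A1)
    (hπ2mem : ∀ t : ℝ, 0 ≤ t → π2 t ∈ stdSimplex ℝ A2)
    -- the selections are best responses almost everywhere
    (ha1 : ∀ᵐ t ∂(volume.restrict (Set.Ici (0:ℝ))), ∃ b1 : A1,
      (∀ c1, ∑ b2, Qt1 c1 b2 * π2 t b2 ≤ ∑ b2, Qt1 b1 b2 * π2 t b2) ∧ a1f t = vert b1)
    (ha2 : ∀ᵐ t ∂(volume.restrict (Set.Ici (0:ℝ))), ∃ b2 : A2,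
      (∀ c2, ∑ b1, π1 t b1 * Qt2 b1 c2 ≤ ∑ b1, π1 t b1 * Qt2 b1 b2) ∧ a2f t = vert b2)
    -- local integrability of the right-hand sides
    (hint1 : ∀ T : ℝ, IntegrableOn (fun τ => a1f τ - π1 τ) (Set.Icc 0 T))
    (hint2 : ∀ T : ℝ, IntegrableOn (fun τ => a2f τ - π2 τ) (Set.Icc 0 T))
    -- the integral form of the best-response differential inclusion
    (heq1 : ∀ t : ℝ, 0 ≤ t → π1 t = π1 0 + ∫ τ in (0:ℝ)..t, (a1f τ - π1 τ))
    (heq2 : ∀ t : ℝ, 0 ≤ t → π2 t = π2 0 + ∫ τ in (0:ℝ)..t, (a2f τ - π2 τ)) :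
    ∀ t t' : ℝ, 0 ≤ t → t < t' →
      Vlyap Qt1 Qt2 l (π1 t') (π2 t') ≤ Vlyap Qt1 Qt2 l (π1 t) (π2 t) ∧
      (Vlyap Qt1 Qt2 l (π1 t') (π2 t') = Vlyap Qt1 Qt2 l (π1 t) (π2 t) ↔
        Vlyap Qt1 Qt2 l (π1 t) (π2 t) = 0) := by
  intro t t' ht htt'
  simp only [Vlyap, h2_eq_h1_swap]
  set M := maxNorm fun b1 b2 => Qt1 b1 b2 + Qt2 b1 b2 with hM
  have hM0 : 0 ≤ M := maxNorm_nonneg _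
  set H : ℝ → ℝ := fun s => h1 Qt1 (π2 s) + h1 (fun b a => Qt2 a b) (π1 s) with hH
  obtain ⟨hac1, hd1⟩ := h1_along_trajectory Qt1 hπ2mem (ha2.mono fun _ ⟨b, _, hb⟩ => ⟨b, hb⟩)
    hint2 heq2 ht htt'.le
  obtain ⟨hac2, hd2⟩ := h1_along_trajectory (fun b a => Qt2 a b) hπ1mem
    (ha1.mono fun _ ⟨b, _, hb⟩ => ⟨b, hb⟩) hint1 heq1 ht htt'.le
  have hexp : AbsolutelyContinuousOnInterval Real.exp t t' :=
    (Real.contDiff_exp (n := 1)).contDiffOn.absolutelyContinuousOnInterval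
  have hconst : AbsolutelyContinuousOnInterval (fun _ : ℝ => M) t t' :=
    (LipschitzWith.const M).lipschitzOnWith.absolutelyContinuousOnInterval
  have hdecay : Real.exp t' * (H t' - M) ≤ Real.exp t * (H t - M) := by
    refine AbsolutelyContinuousOnInterval.le_of_ae_deriv_nonpos
      (F := fun s => Real.exp s * (H s - M)) htt'.le
      (hexp.mul ((hac1.add hac2).sub hconst)) ?_
    filter_upwards [hd1, hd2, (ae_restrict_iff' measurableSet_Ici).1 ha1,
      (ae_restrict_iff' measurableSet_Ici).1 ha2] with s hs1 hs2 hb1 hb2 hmem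
    obtain ⟨b1, hbest1, hv1⟩ := hb1 (ht.trans hmem.1.le)
    obtain ⟨b2, hbest2, hv2⟩ := hb2 (ht.trans hmem.1.le)
    have hder := (Real.hasDerivAt_exp s).mul
      (((hs1 hmem b1 b2 hbest1 hv2).add
        (hs2 hmem b2 b1 (by simpa only [mul_comm] using hbest2) hv1)).sub_const M)
    refine (hder.deriv.trans_le ?_ :)
    have hle : Qt1 b1 b2 + Qt2 b1 b2 ≤ M := le_maxNorm (fun b1 b2 => Qt1 b1 b2 + Qt2 b1 b2) b1 b2
    have := mul_nonneg (Real.exp_pos s).le (sub_nonneg.2 hle)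
    simp only [Pi.add_apply]
    linarith
  have hlt : Real.exp t < Real.exp t' := Real.exp_lt_exp.2 htt'
  have hpos : 0 < Real.exp t := Real.exp_pos t
  have hgap : 0 ≤ (l - 1) * M := mul_nonneg (by linarith) hM0
  change max (H t' - l * M) 0 ≤ max (H t - l * M) 0 ∧
    (max (H t' - l * M) 0 = max (H t - l * M) 0 ↔ max (H t - l * M) 0 = 0)
  have hcontract : Real.exp t' * (H t' - l * M) ≤ Real.exp t * (H t - l * M) := by
    nlinarith
  have hnonpos : H t - l * M ≤ 0 → H t' - l * M ≤ 0 := fun h => by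
    by_contra! hc
    nlinarith [mul_pos (hpos.trans hlt) hc]
  have hstrict : 0 < H t - l * M → H t' - l * M < H t - l * M := fun h => by
    by_contra! hc
    nlinarith
  rcases le_or_gt (H t - l * M) 0 with h | h
  · simp [max_eq_right h, max_eq_right (hnonpos h)]
  · have hmax : max (H t' - l * M) 0 < max (H t - l * M) 0 := by
      rw [max_eq_left h.le]
      exact max_lt (hstrict h) h
    exact ⟨hmax.le, ⟨fun heq => absurd heq hmax.ne, fun h0 => by
      rw [max_eq_left h.le] at h0
      exact absurd h0 h.ne'⟩⟩
end

section
/- In the model-based fictitious play under Assumption 1, for every state s ∈ S: lim_{k→∞} (v̂_{1,k}(s) + v̂_{2,k}(s)) = 0; that is, the two players' estimates of continuation payoffs asymptotically sum to zero at every state. -/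
open Finset Filter Topology

variable {S A1 A2 : Type} [Fintype S] [Fintype A1] [Fintype A2]
    [Nonempty S] [Nonempty A1] [Nonempty A2]
    [DecidableEq S] [DecidableEq A1] [DecidableEq A2]

/-- A Lipschitz function, bounded above, whose derivative is almost everywhere at most
`d - V`, satisfies `V 0 ≤ d`. -/
lemma LipschitzWith.apply_zero_le_of_ae_deriv_le {K : NNReal} {V : ℝ → ℝ} {C d : ℝ}
    (hV : LipschitzWith K V) (hC : ∀ t, V t ≤ C) (hd : ∀ᵐ t, deriv V t ≤ d - V t) :
    V 0 ≤ d := by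
  have key : ∀ t ≤ (0 : ℝ), V 0 - d ≤ (V t - d) * Real.exp t := by
    intro t ht
    have hf : AbsolutelyContinuousOnInterval (fun s => V s - d) t 0 := by
      refine LipschitzOnWith.absolutelyContinuousOnInterval (K := K) ?_
      intro a _ b _
      simpa using hV a b
    have hg : AbsolutelyContinuousOnInterval Real.exp t 0 := by
      have : LipschitzOnWith 1 Real.exp (Set.uIcc t 0) := by
        refine (convex_uIcc t 0).lipschitzOnWith_of_nnnorm_deriv_le
          (fun x _ => Real.differentiableAt_exp) ?_
        intro x hx
        rw [Set.uIcc_of_le ht] at hx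
        rw [Real.deriv_exp, ← NNReal.coe_le_coe]
        simpa using hx.2
      exact this.absolutelyContinuousOnInterval
    have h1 := hf.integral_deriv_mul_eq_sub hg
    have h2 : ∫ x in t..0, (deriv (fun s => V s - d) x * Real.exp x
        + (V x - d) * deriv Real.exp x) ≤ 0 := by
      rw [intervalIntegral.integral_of_le ht]
      refine MeasureTheory.integral_nonpos_of_ae ?_
      refine MeasureTheory.ae_restrict_of_ae ?_
      filter_upwards [hd] with x hx
      rw [Real.deriv_exp, deriv_sub_const, ← add_mul]
      exact mul_nonpos_of_nonpos_of_nonneg (by linarith) (Real.exp_pos x).le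
    simp only [Real.exp_zero, mul_one] at h1
    linarith
  have hlim : Tendsto (fun t => (C - d) * Real.exp t) atBot (𝓝 0) := by
    simpa using Real.tendsto_exp_atBot.const_mul (C - d)
  have : V 0 - d ≤ 0 := by
    refine ge_of_tendsto hlim ?_
    filter_upwards [eventually_le_atBot (0 : ℝ)] with t ht
    refine (key t ht).trans ?_
    exact mul_le_mul_of_nonneg_right (by linarith [hC t]) (Real.exp_pos t).le
  linarith

lemma HasDerivAt.le_of_forall_sub_le {f : ℝ → ℝ} {f' t c K : ℝ} (hf : HasDerivAt f f' t)
    (h : ∀ η > 0, f (t + η) - f t ≤ η * c + K * η ^ 2) : f' ≤ c := by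
  have h2 : Tendsto (fun η : ℝ => c + K * η) (𝓝[>] 0) (𝓝 c) := by
    have : Tendsto (fun η : ℝ => c + K * η) (𝓝 0) (𝓝 (c + K * 0)) := by
      apply Continuous.tendsto; fun_prop
    simpa using this.mono_left nhdsWithin_le_nhds
  refine le_of_tendsto_of_tendsto hf.tendsto_slope_zero_right h2 ?_
  filter_upwards [self_mem_nhdsWithin] with η hη
  have hη : 0 < η := hη
  rw [smul_eq_mul, inv_mul_le_iff₀ hη]
  nlinarith [h η hη]

lemma eventually_abs_le_of_averaging {z w β : ℕ → ℝ} (hβ : ∀ n, β n ∈ Set.Ioc (0 : ℝ) 1)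
    (hsum : Tendsto (fun n => ∑ c ∈ range n, β c) atTop atTop)
    (hz : ∀ n, z (n + 1) = z n + β n * (w n - z n)) {W δ : ℝ} (hδ : 0 < δ)
    (hw : ∀ᶠ n in atTop, |w n| ≤ W) : ∀ᶠ n in atTop, |z n| ≤ W + δ := by
  obtain ⟨N, hN⟩ := eventually_atTop.1 hw
  set σ : ℕ → ℝ := fun n => ∑ c ∈ range n, β c with hσ
  set M := max (|z N| - W) 0
  have key : ∀ n ≥ N, |z n| - W ≤ Real.exp (σ N - σ n) * M := by
    intro n hn
    induction n, hn using Nat.le_induction with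
    | base => simp [M]
    | succ n hn ih =>
      have hb := hβ n
      have e1 : |z (n + 1)| - W ≤ (1 - β n) * (|z n| - W) := by
        have : z (n + 1) = (1 - β n) * z n + β n * w n := by rw [hz]; ring
        have h3 : |z (n + 1)| ≤ (1 - β n) * |z n| + β n * |w n| := by
          rw [this]
          refine (abs_add_le _ _).trans ?_
          rw [abs_mul, abs_mul, abs_of_nonneg (by linarith [hb.2] : 0 ≤ 1 - β n),
            abs_of_pos hb.1]
        nlinarith [hN n hn, hb.1]
      have e2 : σ N - σ (n + 1) = -β n + (σ N - σ n) := by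
        simp only [hσ, sum_range_succ]; ring
      rw [e2, Real.exp_add, mul_assoc]
      calc _ ≤ (1 - β n) * (|z n| - W) := e1
        _ ≤ (1 - β n) * (Real.exp (σ N - σ n) * M) :=
          mul_le_mul_of_nonneg_left ih (by linarith [hb.2])
        _ ≤ _ := mul_le_mul_of_nonneg_right (by linarith [Real.add_one_le_exp (-β n)])
          (mul_nonneg (Real.exp_pos _).le (le_max_right _ _))
  have hlim : Tendsto (fun n => Real.exp (σ N - σ n) * M) atTop (𝓝 0) := by
    have : Tendsto (fun n => σ N - σ n) atTop atBot :=
      tendsto_atBot_add_const_left _ _ (tendsto_neg_atTop_atBot.comp hsum)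
    simpa using (Real.tendsto_exp_atBot.comp this).mul_const M
  filter_upwards [eventually_ge_atTop N, hlim.eventually (gt_mem_nhds hδ)] with n hn h1
  linarith [key n hn]

lemma exists_index_shift {α : ℕ → ℝ} (hα : ∀ n, α n ∈ Set.Ioc (0 : ℝ) 1)
    (hsum : Tendsto (fun n => ∑ c ∈ range n, α c) atTop atTop)
    (h0 : Tendsto α atTop (𝓝 0)) :
    ∃ N : ℝ → ℕ → ℕ, N 0 = id ∧ (∀ t, Tendsto (N t) atTop atTop) ∧
      ∀ t, Tendsto (fun n => ∑ c ∈ range (N t n), α c - ∑ c ∈ range n, α c) atTop (𝓝 t) := by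
  set τ : ℕ → ℝ := fun n => ∑ c ∈ range n, α c with hτ
  have hstep : ∀ n, τ (n + 1) = τ n + α n := fun n => by simp [hτ, sum_range_succ]
  have hmono : Monotone τ := monotone_nat_of_le_succ fun n => by
    rw [hstep]; linarith [(hα n).1]
  have hfloor : ∀ u : ℝ, ∃ m, 0 ≤ u → τ m ≤ u ∧ u < τ (m + 1) := by
    intro u
    by_cases hu : 0 ≤ u
    · obtain ⟨k, hk⟩ := (hsum.eventually_gt_atTop u).exists
      classical
      have hex : ∃ k, u < τ k := ⟨k, hk⟩
      have hpos : Nat.find hex ≠ 0 := by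
        intro h
        have := Nat.find_spec hex
        rw [h] at this
        simp [hτ] at this
        linarith
      obtain ⟨m, hm⟩ := Nat.exists_eq_succ_of_ne_zero hpos
      refine ⟨m, fun _ => ⟨?_, ?_⟩⟩
      · exact not_lt.1 (Nat.find_min hex (by omega))
      · have := Nat.find_spec hex
        rwa [hm] at this
    · exact ⟨0, fun h => absurd h hu⟩
  choose F hF using hfloor
  have hFtop : Tendsto F atTop atTop := by
    refine tendsto_atTop.2 fun b => ?_
    filter_upwards [eventually_ge_atTop (τ b), eventually_ge_atTop 0] with u hu hu0
    by_contra! hlt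
    have := hmono (Nat.succ_le_of_lt hlt)
    linarith [(hF u hu0).2]
  have hshift : ∀ t, Tendsto (fun n => τ n + t) atTop atTop := fun t =>
    tendsto_atTop_add_const_right _ _ hsum
  classical
  refine ⟨fun t => if t = 0 then id else fun n => F (τ n + t), by simp, ?_, ?_⟩
  · intro t
    by_cases ht : t = 0
    · simp only [ht, if_true]; exact tendsto_id
    · simp only [ht, if_false]; exact hFtop.comp (hshift t)
  · intro t
    by_cases ht : t = 0
    · simp [ht]
    · simp only [ht, if_false]
      have hlow : Tendsto (fun n => t - α (F (τ n + t))) atTop (𝓝 t) := by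
        simpa using tendsto_const_nhds.sub (h0.comp (hFtop.comp (hshift t)))
      refine tendsto_of_tendsto_of_tendsto_of_le_of_le' hlow tendsto_const_nhds ?_ ?_
      · filter_upwards [(hshift t).eventually_ge_atTop 0] with n hn
        have := (hF _ hn).2
        rw [hstep] at this
        change _ ≤ τ _ - τ n
        linarith
      · filter_upwards [(hshift t).eventually_ge_atTop 0] with n hn
        have := (hF _ hn).1
        change τ _ - τ n ≤ _
        linarith

/-- A Lipschitz path `X` of beliefs in continuous time that moves towards best responses
to the path `Y` in the game with payoff matrix `P`, in difference-quotient form. -/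
structure BestResponsePath {A B : Type} [Fintype A] [Fintype B]
    (X : ℝ → A → ℝ) (Y : ℝ → B → ℝ) (P : A → B → ℝ) : Prop where
  lipschitz : ∀ c t s, |X t c - X s c| ≤ |t - s|
  abs_le_one : ∀ t c, |X t c| ≤ 1
  upper : ∀ (w : A → ℝ) (M : ℝ), (∀ c, w c ≤ M) → ∃ K : ℝ, ∀ t, ∀ η > 0,
    ∑ c, (X (t + η) c - X t c) * w c ≤ η * (M - ∑ c, X t c * w c) + K * η ^ 2
  lower : ∃ K : ℝ, ∀ t, ∀ η > 0, ∀ c',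
    η * (∑ b, P c' b * Y t b - ∑ c, X t c * ∑ b, P c b * Y t b) - K * η ^ 2
      ≤ ∑ c, (X (t + η) c - X t c) * ∑ b, P c b * Y t b

section BestResponsePath

variable {A B : Type} [Fintype A] [Fintype B]

/-- The best-response value of the payoff matrix `P` against `y`. -/
noncomputable def responseValue [Nonempty A] (P : A → B → ℝ) (y : B → ℝ) : ℝ :=
  univ.sup' univ_nonempty fun c => ∑ b, P c b * y b

lemma le_responseValue [Nonempty A] (P : A → B → ℝ) (y : B → ℝ) (c : A) :
    ∑ b, P c b * y b ≤ responseValue P y :=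
  le_sup' (fun c => ∑ b, P c b * y b) (mem_univ c)

lemma responseValue_le [Nonempty A] {P : A → B → ℝ} {y : B → ℝ} {M : ℝ}
    (h : ∀ c, ∑ b, P c b * y b ≤ M) : responseValue P y ≤ M :=
  sup'_le _ _ fun c _ => h c

lemma exists_eq_responseValue [Nonempty A] (P : A → B → ℝ) (y : B → ℝ) :
    ∃ c, responseValue P y = ∑ b, P c b * y b := by
  obtain ⟨c, -, hc⟩ := exists_mem_eq_sup' univ_nonempty fun c : A => ∑ b, P c b * y b
  exact ⟨c, hc⟩

lemma abs_sum_mul_le {P : A → B → ℝ} {y : B → ℝ} {δ : ℝ} (h : ∀ b, |y b| ≤ δ) (c : A) :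
    |∑ b, P c b * y b| ≤ (∑ c, ∑ b, |P c b|) * δ := by
  calc |∑ b, P c b * y b| ≤ ∑ b, |P c b * y b| := abs_sum_le_sum_abs _ _
    _ ≤ ∑ b, |P c b| * δ := sum_le_sum fun b _ => by
        rw [abs_mul]; exact mul_le_mul_of_nonneg_left (h b) (abs_nonneg _)
    _ = (∑ b, |P c b|) * δ := by rw [sum_mul]
    _ ≤ _ := by
        rcases isEmpty_or_nonempty B with hB | ⟨⟨b⟩⟩
        · simp
        · refine mul_le_mul_of_nonneg_right ?_ ((abs_nonneg _).trans (h b))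
          exact single_le_sum (f := fun c => ∑ b, |P c b|)
            (fun c _ => sum_nonneg fun b _ => abs_nonneg _) (mem_univ c)

lemma abs_responseValue_sub_le [Nonempty A] {P : A → B → ℝ} {y z : B → ℝ} {δ : ℝ}
    (h : ∀ b, |y b - z b| ≤ δ) :
    |responseValue P y - responseValue P z| ≤ (∑ c, ∑ b, |P c b|) * δ := by
  have key : ∀ {y z : B → ℝ}, (∀ b, |y b - z b| ≤ δ) →
      responseValue P y - responseValue P z ≤ (∑ c, ∑ b, |P c b|) * δ := by
    intro y z h
    rw [sub_le_iff_le_add]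
    refine responseValue_le fun c => ?_
    have h1 := (abs_le.1 (abs_sum_mul_le (P := P) h c)).2
    have h2 : ∑ b, P c b * (y b - z b) = ∑ b, P c b * y b - ∑ b, P c b * z b := by
      simp [mul_sub]
    linarith [le_responseValue P z c]
  rw [abs_sub_le_iff]
  exact ⟨key h, key fun b => by rw [abs_sub_comm]; exact h b⟩

lemma tendsto_responseValue [Nonempty A] {F : Filter ℕ} {P : ℕ → A → B → ℝ}
    {y : ℕ → B → ℝ} {P' : A → B → ℝ} {y' : B → ℝ}
    (hP : ∀ c b, Tendsto (fun n => P n c b) F (𝓝 (P' c b)))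
    (hy : ∀ b, Tendsto (fun n => y n b) F (𝓝 (y' b))) :
    Tendsto (fun n => responseValue (P n) (y n)) F (𝓝 (responseValue P' y')) :=
  Tendsto.finset_sup'_nhds_apply _ fun c _ =>
    tendsto_finsetSum _ fun b _ => (hP c b).mul (hy b)

lemma lipschitzWith_responseValue [Nonempty A] {P : A → B → ℝ} {Y : ℝ → B → ℝ}
    (hY : ∀ b t s, |Y t b - Y s b| ≤ |t - s|) :
    ∃ K, LipschitzWith K fun t => responseValue P (Y t) := by
  refine ⟨(∑ c, ∑ b, |P c b|).toNNReal, LipschitzWith.of_dist_le_mul fun t s => ?_⟩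
  rw [Real.dist_eq, Real.dist_eq, Real.coe_toNNReal _
    (sum_nonneg fun _ _ => sum_nonneg fun _ _ => abs_nonneg _)]
  exact abs_responseValue_sub_le fun b => hY b t s

lemma ae_hasDerivAt_of_abs_sub_le {X : ℝ → A → ℝ} (hX : ∀ c t s, |X t c - X s c| ≤ |t - s|) :
    ∀ᵐ t, ∀ c, HasDerivAt (fun s => X s c) (deriv (fun s => X s c) t) t := by
  refine MeasureTheory.ae_all_iff.2 fun c => ?_
  have : LipschitzWith 1 fun s => X s c := LipschitzWith.of_dist_le_mul fun t s => by
    simpa [Real.dist_eq] using hX c t s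
  filter_upwards [this.ae_differentiableAt_real] with t ht
  exact ht.hasDerivAt

namespace BestResponsePath

variable {X : ℝ → A → ℝ} {Y : ℝ → B → ℝ} {P : A → B → ℝ} {t : ℝ} {X' : A → ℝ} {Y' : B → ℝ}

lemma sum_deriv_mul_le (h : BestResponsePath X Y P)
    (hX : ∀ c, HasDerivAt (fun s => X s c) (X' c) t) {w : A → ℝ} {M : ℝ} (hw : ∀ c, w c ≤ M) :
    ∑ c, (X' c + X t c) * w c ≤ M := by
  obtain ⟨K, hK⟩ := h.upper w M hw
  have hd : HasDerivAt (fun s => ∑ c, X s c * w c) (∑ c, X' c * w c) t :=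
    HasDerivAt.fun_sum fun c _ => (hX c).mul_const (w c)
  have := hd.le_of_forall_sub_le (c := M - ∑ c, X t c * w c) (K := K) fun η hη => by
    rw [← sum_sub_distrib]
    simpa only [sub_mul] using hK t η hη
  simp only [add_mul, sum_add_distrib]
  linarith

lemma responseValue_eq [Nonempty A] (h : BestResponsePath X Y P)
    (hX : ∀ c, HasDerivAt (fun s => X s c) (X' c) t) :
    responseValue P (Y t) = ∑ c, (X' c + X t c) * ∑ b, P c b * Y t b := by
  refine le_antisymm ?_ (h.sum_deriv_mul_le hX fun c => le_responseValue P (Y t) c)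
  refine responseValue_le fun c' => ?_
  obtain ⟨K, hK⟩ := h.lower
  have hd : HasDerivAt (fun s => -∑ c, X s c * ∑ b, P c b * Y t b)
      (-∑ c, X' c * ∑ b, P c b * Y t b) t :=
    (HasDerivAt.fun_sum fun c _ => (hX c).mul_const _).neg
  have := hd.le_of_forall_sub_le
    (c := -(∑ b, P c' b * Y t b - ∑ c, X t c * ∑ b, P c b * Y t b)) (K := K) fun η hη => by
    have h1 := hK t η hη c'
    simp only [sub_mul, sum_sub_distrib] at h1
    linarith
  simp only [add_mul, sum_add_distrib]
  linarith

lemma deriv_responseValue_eq [Nonempty A] (h : BestResponsePath X Y P)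
    (hX : ∀ c, HasDerivAt (fun s => X s c) (X' c) t)
    (hY : ∀ b, HasDerivAt (fun s => Y s b) (Y' b) t) {v' : ℝ}
    (hv : HasDerivAt (fun s => responseValue P (Y s)) v' t) :
    v' = ∑ c, (X' c + X t c) * ∑ b, P c b * Y' b := by
  have hd : HasDerivAt (fun s => responseValue P (Y s)
      - ∑ c, (X' c + X t c) * ∑ b, P c b * Y s b)
      (v' - ∑ c, (X' c + X t c) * ∑ b, P c b * Y' b) t :=
    hv.sub (HasDerivAt.fun_sum fun c _ => HasDerivAt.const_mul _
      (HasDerivAt.fun_sum fun b _ => (hY b).const_mul _))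
  have hmin : IsLocalMin (fun s => responseValue P (Y s)
      - ∑ c, (X' c + X t c) * ∑ b, P c b * Y s b) t := by
    refine Eventually.of_forall fun s => ?_
    have h1 := h.sum_deriv_mul_le hX fun c => le_responseValue P (Y s) c
    have h2 := h.responseValue_eq hX
    simp only
    linarith
  linarith [hmin.hasDerivAt_eq_zero hd]

/-- Along a pair of mutual best-response paths the values at time `0` add up to at most the
largest entry of the sum of the payoff matrices. -/
lemma responseValue_add_le [Nonempty A] [Nonempty B] {R : B → A → ℝ} {d : ℝ}
    (h : BestResponsePath X Y P) (h' : BestResponsePath Y X R)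
    (hd : ∀ c b, P c b + R b c ≤ d) :
    responseValue P (Y 0) + responseValue R (X 0) ≤ d := by
  obtain ⟨K1, hK1⟩ := lipschitzWith_responseValue (P := P) h'.lipschitz
  obtain ⟨K2, hK2⟩ := lipschitzWith_responseValue (P := R) h.lipschitz
  refine (hK1.add hK2).apply_zero_le_of_ae_deriv_le
    (C := (∑ c, ∑ b, |P c b|) * 1 + (∑ c, ∑ b, |R c b|) * 1) (fun t => ?_) ?_
  · exact add_le_add
      (responseValue_le fun c => (abs_le.1 (abs_sum_mul_le (h'.abs_le_one t) c)).2)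
      (responseValue_le fun c => (abs_le.1 (abs_sum_mul_le (h.abs_le_one t) c)).2)
  · filter_upwards [ae_hasDerivAt_of_abs_sub_le h.lipschitz,
      ae_hasDerivAt_of_abs_sub_le h'.lipschitz, hK1.ae_differentiableAt_real,
      hK2.ae_differentiableAt_real] with t hX hY hv1 hv2
    have hv := hv1.hasDerivAt.add hv2.hasDerivAt
    rw [show deriv (fun t => responseValue P (Y t) + responseValue R (X t)) t = _ from hv.deriv]
    have e1 := h.deriv_responseValue_eq hX hY hv1.hasDerivAt
    have e2 := h'.deriv_responseValue_eq hY hX hv2.hasDerivAt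
    have e3 := h.responseValue_eq hX
    have e4 := h'.responseValue_eq hY
    have hle : ∑ c, (deriv (fun s => X s c) t + X t c) *
        ∑ b, (deriv (fun s => Y s b) t + Y t b) * (P c b + R b c) ≤ d :=
      h.sum_deriv_mul_le hX fun c => h'.sum_deriv_mul_le hY fun b => hd c b
    have hswap : ∑ b, (deriv (fun s => Y s b) t + Y t b) *
        ∑ c, R b c * (deriv (fun s => X s c) t + X t c)
        = ∑ c, (deriv (fun s => X s c) t + X t c) *
          ∑ b, (deriv (fun s => Y s b) t + Y t b) * R b c := by
      simp only [mul_sum]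
      rw [sum_comm]
      exact sum_congr rfl fun c _ => sum_congr rfl fun b _ => by ring
    have hsplit : ∑ c, (deriv (fun s => X s c) t + X t c) *
        ∑ b, (deriv (fun s => Y s b) t + Y t b) * (P c b + R b c)
        = ∑ c, (deriv (fun s => X s c) t + X t c) *
            ∑ b, P c b * (deriv (fun s => Y s b) t + Y t b)
          + ∑ b, (deriv (fun s => Y s b) t + Y t b) *
            ∑ c, R b c * (deriv (fun s => X s c) t + X t c) := by
      rw [hswap, ← sum_add_distrib]
      refine sum_congr rfl fun c _ => ?_
      rw [← mul_add, ← sum_add_distrib]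
      exact congrArg _ (sum_congr rfl fun b _ => by ring)
    rw [hsplit] at hle
    simp only [mul_add, sum_add_distrib] at hle e1 e2 e3 e4
    linarith

end BestResponsePath

end BestResponsePath

/-- One player's side of fictitious play in discrete time: `x` is the belief on the player's own
strategy, `y` the belief on the opponent's strategy, `P` the slowly varying payoff matrix and `a`
the sequence of best responses. -/
structure FictitiousPlay {A B : Type} [Fintype A] [Fintype B] [DecidableEq A]
    (α ε : ℕ → ℝ) (C : ℝ) (x : ℕ → A → ℝ) (y : ℕ → B → ℝ) (P : ℕ → A → B → ℝ) (a : ℕ → A) :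
    Prop where
  mem_simplex : ∀ n, x n ∈ stdSimplex ℝ A
  update : ∀ n c, x (n + 1) c = x n c + α n * ((if c = a n then 1 else 0) - x n c)
  best_response : ∀ n c, ∑ b, P n c b * y n b ≤ ∑ b, P n (a n) b * y n b
  bounded : ∀ n c b, |P n c b| ≤ C
  slow : ∀ n c b, |P (n + 1) c b - P n c b| ≤ ε n * α n

section FictitiousPlay

variable {α ε : ℕ → ℝ} {C : ℝ}

lemma abs_sub_le_of_abs_step_le {f : ℕ → ℝ} {η : ℝ} {i j : ℕ}
    (hf : ∀ m ≥ i, |f (m + 1) - f m| ≤ η * α m) (hij : i ≤ j) :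
    |f j - f i| ≤ η * (∑ c ∈ range j, α c - ∑ c ∈ range i, α c) := by
  induction j, hij using Nat.le_induction with
  | base => simp
  | succ m hm ih =>
    rw [sum_range_succ]
    have := abs_sub_le (f (m + 1)) (f m) (f i)
    nlinarith [hf m hm]

lemma abs_sub_le_of_abs_step_le' (hα : ∀ n, α n ∈ Set.Ioc (0 : ℝ) 1) {f : ℕ → ℝ} {η : ℝ}
    {k i j : ℕ} (hf : ∀ m ≥ k, |f (m + 1) - f m| ≤ η * α m) (hi : k ≤ i) (hj : k ≤ j) :
    |f j - f i| ≤ η * |∑ c ∈ range j, α c - ∑ c ∈ range i, α c| := by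
  have hmono : Monotone fun n => ∑ c ∈ range n, α c := monotone_nat_of_le_succ fun n => by
    rw [sum_range_succ]; linarith [(hα n).1]
  rcases le_total i j with h | h
  · rw [abs_of_nonneg (sub_nonneg.2 (hmono h))]
    exact abs_sub_le_of_abs_step_le (fun m hm => hf m (hi.trans hm)) h
  · rw [abs_sub_comm, abs_sub_comm (∑ c ∈ range j, α c), abs_of_nonneg (sub_nonneg.2 (hmono h))]
    exact abs_sub_le_of_abs_step_le (fun m hm => hf m (hj.trans hm)) h

lemma tendsto_shift_sub_zero (hα : ∀ n, α n ∈ Set.Ioc (0 : ℝ) 1)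
    (hε : Tendsto ε atTop (𝓝 0)) {f : ℕ → ℝ} (hf : ∀ m, |f (m + 1) - f m| ≤ ε m * α m)
    {N : ℕ → ℕ} {t : ℝ} (hN : Tendsto N atTop atTop)
    (ht : Tendsto (fun n => ∑ c ∈ range (N n), α c - ∑ c ∈ range n, α c) atTop (𝓝 t)) :
    Tendsto (fun n => f (N n) - f n) atTop (𝓝 0) := by
  refine Metric.tendsto_nhds.2 fun δ hδ => ?_
  have hpos : 0 < |t| + 1 := by positivity
  obtain ⟨k, hk⟩ := eventually_atTop.1 (hε.eventually (gt_mem_nhds (div_pos hδ hpos)))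
  have hstep : ∀ m ≥ k, |f (m + 1) - f m| ≤ δ / (|t| + 1) * α m := fun m hm =>
    (hf m).trans (mul_le_mul_of_nonneg_right (hk m hm).le (hα m).1.le)
  filter_upwards [hN.eventually_ge_atTop k, eventually_ge_atTop k,
    ht.abs.eventually (gt_mem_nhds (lt_add_one |t|))] with n h1 h2 h3
  rw [Real.dist_eq, sub_zero]
  calc _ ≤ _ := abs_sub_le_of_abs_step_le' hα hstep h2 h1
    _ < δ / (|t| + 1) * (|t| + 1) := mul_lt_mul_of_pos_left h3 (div_pos hδ hpos)
    _ = δ := div_mul_cancel₀ _ hpos.ne'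

lemma Ultrafilter.exists_tendsto_of_abs_le (U : Ultrafilter ℕ) {f : ℕ → ℝ}
    (hf : ∀ n, |f n| ≤ C) : ∃ l, Tendsto f U (𝓝 l) := by
  obtain ⟨l, -, hl⟩ := (isCompact_Icc (a := -C) (b := C)).ultrafilter_le_nhds (U.map f)
    (le_principal_iff.2 (Ultrafilter.mem_map.2 (Filter.univ_mem' fun n => abs_le.1 (hf n))))
  exact ⟨l, hl⟩

namespace FictitiousPlay

variable {A B : Type} [Fintype A] [Fintype B] [DecidableEq A]
  {x : ℕ → A → ℝ} {y : ℕ → B → ℝ} {P : ℕ → A → B → ℝ} {a : ℕ → A}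

lemma abs_belief_le_one (h : FictitiousPlay α ε C x y P a) (n : ℕ) (c : A) : |x n c| ≤ 1 := by
  have h1 := mem_Icc_of_mem_stdSimplex (h.mem_simplex n) c
  rw [abs_of_nonneg h1.1]; exact h1.2

lemma abs_step_le (hα : ∀ n, α n ∈ Set.Ioc (0 : ℝ) 1) (h : FictitiousPlay α ε C x y P a)
    (n : ℕ) (c : A) : |x (n + 1) c - x n c| ≤ 1 * α n := by
  have h1 := mem_Icc_of_mem_stdSimplex (h.mem_simplex n) c
  rw [h.update, add_sub_cancel_left, abs_mul, abs_of_pos (hα n).1, mul_comm]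
  refine mul_le_mul_of_nonneg_right ?_ (hα n).1.le
  rw [abs_le]
  split_ifs <;> constructor <;> linarith [h1.1, h1.2]

lemma sum_sub_mul_le (hα : ∀ n, α n ∈ Set.Ioc (0 : ℝ) 1) (h : FictitiousPlay α ε C x y P a)
    {w : A → ℝ} {M κ ω : ℝ} {i j : ℕ} (hκ : 0 ≤ κ) (hω : ∑ c, |w c| ≤ ω)
    (hw : ∀ m ≥ i, w (a m) ≤ M + κ * (∑ c ∈ range m, α c - ∑ c ∈ range i, α c))
    (hij : i ≤ j) :
    ∑ c, (x j c - x i c) * w c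
      ≤ (∑ c ∈ range j, α c - ∑ c ∈ range i, α c) * (M - ∑ c, x i c * w c)
        + (κ + ω) * (∑ c ∈ range j, α c - ∑ c ∈ range i, α c) ^ 2 := by
  have hω0 : 0 ≤ ω := (sum_nonneg fun _ _ => abs_nonneg _).trans hω
  induction j, hij using Nat.le_induction with
  | base => simp
  | succ m hm ih =>
    set θ := ∑ c ∈ range m, α c - ∑ c ∈ range i, α c with hθ
    have hθ1 : ∑ c ∈ range (m + 1), α c - ∑ c ∈ range i, α c = θ + α m := by
      rw [sum_range_succ]; ring
    have hθ0 : 0 ≤ θ := sub_nonneg.2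
      (sum_le_sum_of_subset_of_nonneg (range_mono hm) fun k _ _ => (hα k).1.le)
    have hαm := (hα m).1
    have hS : ∑ c, (x (m + 1) c - x i c) * w c
        = ∑ c, (x m c - x i c) * w c + α m * (w (a m) - ∑ c, x m c * w c) := by
      have e : w (a m) = ∑ c, (if c = a m then 1 else 0) * w c := by simp
      rw [e, ← sum_sub_distrib, mul_sum, ← sum_add_distrib]
      refine sum_congr rfl fun c _ => ?_
      rw [h.update]; ring
    have hx : ∑ c, x m c * w c = ∑ c, (x m c - x i c) * w c + ∑ c, x i c * w c := by
      rw [← sum_add_distrib]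
      exact sum_congr rfl fun c _ => by ring
    have habs : -(ω * θ) ≤ ∑ c, (x m c - x i c) * w c := by
      have h1 : |∑ c, (x m c - x i c) * w c| ≤ ω * θ := by
        refine (abs_sum_le_sum_abs _ _).trans ?_
        refine le_trans ?_ (mul_le_mul_of_nonneg_right hω hθ0)
        rw [sum_mul]
        refine sum_le_sum fun c _ => ?_
        rw [abs_mul, mul_comm]
        refine mul_le_mul_of_nonneg_left ?_ (abs_nonneg _)
        have := abs_sub_le_of_abs_step_le (α := α) (f := fun n => x n c)
          (fun k _ => h.abs_step_le hα k c) hm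
        rwa [one_mul] at this
      exact (abs_le.1 h1).1
    have hgain : α m * (w (a m) - ∑ c, x m c * w c)
        ≤ α m * (M - ∑ c, x i c * w c + (κ + ω) * θ) :=
      mul_le_mul_of_nonneg_left (by linarith [hw m hm]) hαm.le
    rw [hS, hθ1]
    have h2 : 0 ≤ (κ + ω) * (α m * θ + α m ^ 2) := by positivity
    linarith

lemma abs_response_sub_le (h : FictitiousPlay α ε C x y P a) {i m : ℕ} {θ : ℝ}
    (hy1 : ∀ b, |y m b| ≤ 1) (hy : ∀ b, |y m b - y i b| ≤ θ)
    (hP : ∀ c b, |P m c b - P i c b| ≤ θ) (c : A) :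
    |∑ b, P m c b * y m b - ∑ b, P i c b * y i b| ≤ Fintype.card B * (1 + C) * θ := by
  rw [← sum_sub_distrib]
  refine (abs_sum_le_sum_abs _ _).trans ?_
  have : ∀ b ∈ (univ : Finset B), |P m c b * y m b - P i c b * y i b| ≤ (1 + C) * θ := by
    intro b _
    have e : P m c b * y m b - P i c b * y i b
        = (P m c b - P i c b) * y m b + P i c b * (y m b - y i b) := by ring
    rw [e]
    refine (abs_add_le _ _).trans ?_
    rw [abs_mul, abs_mul, add_mul, one_mul]
    have hθ : 0 ≤ θ := (abs_nonneg _).trans (hy b)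
    refine add_le_add ?_ (mul_le_mul (h.bounded i c b) (hy b) (abs_nonneg _)
      ((abs_nonneg _).trans (h.bounded i c b)))
    calc _ ≤ θ * 1 := mul_le_mul (hP c b) (hy1 b) (abs_nonneg _) hθ
      _ = θ := mul_one θ
  refine (sum_le_sum this).trans_eq ?_
  simp [mul_assoc]

lemma mul_sub_le_sum_sub_mul (hα : ∀ n, α n ∈ Set.Ioc (0 : ℝ) 1)
    (h : FictitiousPlay α ε C x y P a)
    (hy1 : ∀ n b, |y n b| ≤ 1) (hy : ∀ n b, |y (n + 1) b - y n b| ≤ 1 * α n)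
    {i j : ℕ} (hε : ∀ n ≥ i, ε n ≤ 1) (hC : 0 ≤ C) (hij : i ≤ j) (c' : A) :
    (∑ c ∈ range j, α c - ∑ c ∈ range i, α c)
        * (∑ b, P i c' b * y i b - ∑ c, x i c * ∑ b, P i c b * y i b)
      - (2 * (Fintype.card B * (1 + C)) + ∑ _c : A, ∑ _b : B, C)
        * (∑ c ∈ range j, α c - ∑ c ∈ range i, α c) ^ 2
      ≤ ∑ c, (x j c - x i c) * ∑ b, P i c b * y i b := by
  have hresp : ∀ m ≥ i, ∀ c, |∑ b, P m c b * y m b - ∑ b, P i c b * y i b|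
      ≤ Fintype.card B * (1 + C) * (∑ c ∈ range m, α c - ∑ c ∈ range i, α c) := by
    intro m hm c
    refine h.abs_response_sub_le (hy1 m) (fun b => ?_) (fun c b => ?_) c
    · simpa only [one_mul] using
        abs_sub_le_of_abs_step_le (f := fun n => y n b) (fun k _ => hy k b) hm
    · have := abs_sub_le_of_abs_step_le (f := fun n => P n c b) (α := α) (η := 1)
        (fun k hk => (h.slow k c b).trans
          (mul_le_mul_of_nonneg_right (hε k hk) (hα k).1.le)) hm
      rwa [one_mul] at this
  have key := h.sum_sub_mul_le hα (w := fun c => -∑ b, P i c b * y i b)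
    (M := -∑ b, P i c' b * y i b) (κ := 2 * (Fintype.card B * (1 + C)))
    (ω := ∑ _c : A, ∑ _b : B, C) (by positivity)
    (sum_le_sum fun c _ => by
      rw [abs_neg]
      refine (abs_sum_le_sum_abs _ _).trans (sum_le_sum fun b _ => ?_)
      rw [abs_mul]
      simpa using mul_le_mul (h.bounded i c b) (hy1 i b) (abs_nonneg _) hC)
    (fun m hm => by
      have h1 := (abs_le.1 (hresp m hm (a m))).2
      have h2 := (abs_le.1 (hresp m hm c')).1
      have h3 := h.best_response m c'
      linarith) hij
  simp only [mul_neg, sum_neg_distrib] at key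
  linarith

/-- Ultralimits of fictitious play along shifted clocks are best-response paths. -/
lemma bestResponsePath_of_tendsto (hα : ∀ n, α n ∈ Set.Ioc (0 : ℝ) 1)
    (hε : Tendsto ε atTop (𝓝 0)) (h : FictitiousPlay α ε C x y P a) (hC : 0 ≤ C)
    (hy1 : ∀ n b, |y n b| ≤ 1) (hy : ∀ n b, |y (n + 1) b - y n b| ≤ 1 * α n)
    {U : Ultrafilter ℕ} (hU : (U : Filter ℕ) ≤ atTop) {N : ℝ → ℕ → ℕ}
    (hN : ∀ t, Tendsto (N t) atTop atTop)
    (hτ : ∀ t, Tendsto (fun n => ∑ c ∈ range (N t n), α c - ∑ c ∈ range n, α c) atTop (𝓝 t))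
    {X : ℝ → A → ℝ} {Y : ℝ → B → ℝ} {P' : A → B → ℝ}
    (hX : ∀ t c, Tendsto (fun n => x (N t n) c) U (𝓝 (X t c)))
    (hY : ∀ t b, Tendsto (fun n => y (N t n) b) U (𝓝 (Y t b)))
    (hP : ∀ c b, Tendsto (fun n => P n c b) U (𝓝 (P' c b))) :
    BestResponsePath X Y P' := by
  have hτ2 : ∀ t s, Tendsto (fun n => ∑ c ∈ range (N t n), α c - ∑ c ∈ range (N s n), α c) U
      (𝓝 (t - s)) := by
    intro t s
    have := ((hτ t).sub (hτ s)).mono_left hU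
    simpa using this
  have hPt : ∀ t c b, Tendsto (fun n => P (N t n) c b) U (𝓝 (P' c b)) := by
    intro t c b
    have h1 := tendsto_shift_sub_zero hα hε (f := fun n => P n c b) (fun m => h.slow m c b)
      (hN t) (hτ t)
    simpa using (h1.mono_left hU).add (hP c b)
  have hresp : ∀ t c, Tendsto (fun n => ∑ b, P (N t n) c b * y (N t n) b) U
      (𝓝 (∑ b, P' c b * Y t b)) := fun t c =>
    tendsto_finsetSum _ fun b _ => (hPt t c b).mul (hY t b)
  have hle : ∀ t, ∀ η > 0, ∀ᶠ n in (U : Filter ℕ), N t n ≤ N (t + η) n := by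
    intro t η hη
    have h1 := hτ2 (t + η) t
    rw [add_sub_cancel_left] at h1
    filter_upwards [h1.eventually (lt_mem_nhds hη)] with n hn
    by_contra! hlt
    have := sum_le_sum_of_subset_of_nonneg (f := α) (range_mono hlt.le)
      fun k _ _ => (hα k).1.le
    linarith
  have hτη : ∀ t η, Tendsto
      (fun n => ∑ c ∈ range (N (t + η) n), α c - ∑ c ∈ range (N t n), α c) U (𝓝 η) := by
    intro t η
    simpa using hτ2 (t + η) t
  refine ⟨fun c t s => ?_, fun t c => ?_, fun w M hw => ?_, ?_⟩
  · refine le_of_tendsto_of_tendsto' ((hX t c).sub (hX s c)).abs (hτ2 t s).abs fun n => ?_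
    simpa using abs_sub_le_of_abs_step_le' (k := 0) hα (f := fun n => x n c)
      (fun m _ => h.abs_step_le hα m c) (Nat.zero_le _) (Nat.zero_le _)
  · exact le_of_tendsto' (hX t c).abs fun n => h.abs_belief_le_one _ c
  · refine ⟨0 + ∑ c, |w c|, fun t η hη => ?_⟩
    refine le_of_tendsto_of_tendsto
      (tendsto_finsetSum _ fun c _ => ((hX (t + η) c).sub (hX t c)).mul_const (w c))
      (((hτη t η).mul (tendsto_const_nhds.sub
        (tendsto_finsetSum _ fun c _ => (hX t c).mul_const (w c)))).add
        (((hτη t η).pow 2).const_mul _)) ?_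
    filter_upwards [hle t η hη] with n hn
    exact h.sum_sub_mul_le hα le_rfl le_rfl (fun m _ => by simpa using hw (a m)) hn
  · refine ⟨2 * (Fintype.card B * (1 + C)) + ∑ _c : A, ∑ _b : B, C, fun t η hη c₀ => ?_⟩
    refine le_of_tendsto_of_tendsto
      (((hτη t η).mul ((hresp t c₀).sub
        (tendsto_finsetSum _ fun c _ => (hX t c).mul (hresp t c)))).sub
        (((hτη t η).pow 2).const_mul _))
      (tendsto_finsetSum _ fun c _ => ((hX (t + η) c).sub (hX t c)).mul (hresp t c)) ?_
    obtain ⟨k, hk⟩ := eventually_atTop.1 (hε.eventually (gt_mem_nhds one_pos))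
    filter_upwards [hle t η hη, hU ((hN t).eventually_ge_atTop k)] with n hn hnk
    exact h.mul_sub_le_sum_sub_mul hα hy1 hy (fun m hm => (hk m (hnk.trans hm)).le) hC hn c₀

/-- In fictitious play with slowly varying payoff matrices, the values of the best responses
eventually add up to at most any asymptotic bound on the sum of the payoff matrices. -/
lemma eventually_responseValue_add_le [Nonempty A] [Nonempty B] [DecidableEq B]
    {R : ℕ → B → A → ℝ} {b : ℕ → B}
    (hα : ∀ n, α n ∈ Set.Ioc (0 : ℝ) 1)
    (hsum : Tendsto (fun n => ∑ c ∈ range n, α c) atTop atTop)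
    (hα0 : Tendsto α atTop (𝓝 0)) (hε : Tendsto ε atTop (𝓝 0))
    (h : FictitiousPlay α ε C x y P a) (h' : FictitiousPlay α ε C y x R b) {d δ : ℝ}
    (hδ : 0 < δ) (hd : ∀ᶠ n in atTop, ∀ c e, P n c e + R n e c ≤ d) :
    ∀ᶠ n in atTop, responseValue (P n) (y n) + responseValue (R n) (x n) ≤ d + δ := by
  by_contra hcon
  have hfreq : ∃ᶠ n in atTop,
      d + δ < responseValue (P n) (y n) + responseValue (R n) (x n) := by
    simpa only [not_eventually, not_le] using hcon
  have hne := frequently_iff_neBot.1 hfreq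
  set U := Ultrafilter.of (atTop ⊓ 𝓟 {n : ℕ |
    d + δ < responseValue (P n) (y n) + responseValue (R n) (x n)})
  have hUle := Ultrafilter.of_le (atTop ⊓ 𝓟 {n : ℕ |
    d + δ < responseValue (P n) (y n) + responseValue (R n) (x n)})
  have hU : (U : Filter ℕ) ≤ atTop := hUle.trans inf_le_left
  have hUmem : ∀ᶠ n in (U : Filter ℕ),
      d + δ < responseValue (P n) (y n) + responseValue (R n) (x n) :=
    le_principal_iff.1 (hUle.trans inf_le_right)
  have hC : 0 ≤ C := (abs_nonneg _).trans
    (h.bounded 0 (Classical.arbitrary A) (Classical.arbitrary B))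
  obtain ⟨N, hN0, hN, hτ⟩ := exists_index_shift hα hsum hα0
  choose X hX using fun t c =>
    U.exists_tendsto_of_abs_le (f := fun n => x (N t n) c) fun n => h.abs_belief_le_one _ c
  choose Y hY using fun t e =>
    U.exists_tendsto_of_abs_le (f := fun n => y (N t n) e) fun n => h'.abs_belief_le_one _ e
  choose P' hP' using fun c e =>
    U.exists_tendsto_of_abs_le (f := fun n => P n c e) fun n => h.bounded n c e
  choose R' hR' using fun e c =>
    U.exists_tendsto_of_abs_le (f := fun n => R n e c) fun n => h'.bounded n e c
  have path := h.bestResponsePath_of_tendsto hα hε hC h'.abs_belief_le_one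
    (h'.abs_step_le hα) hU hN hτ hX hY hP'
  have path' := h'.bestResponsePath_of_tendsto hα hε hC h.abs_belief_le_one
    (h.abs_step_le hα) hU hN hτ hY hX hR'
  have hd' : ∀ c e, P' c e + R' e c ≤ d := fun c e =>
    le_of_tendsto ((hP' c e).add (hR' e c)) ((hd.filter_mono hU).mono fun n hn => hn c e)
  have hX0 := hX 0
  have hY0 := hY 0
  rw [hN0] at hX0 hY0
  have hlim := (tendsto_responseValue hP' hY0).add (tendsto_responseValue hR' hX0)
  have h1 := ge_of_tendsto hlim (hUmem.mono fun n hn => hn.le)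
  linarith [path.responseValue_add_le path' hd']

end FictitiousPlay

end FictitiousPlay

section Simplex

variable {A B : Type} [Fintype A] [Fintype B] {x : A → ℝ} {y : B → ℝ}

lemma sum_mul_le_of_mem_stdSimplex (hx : x ∈ stdSimplex ℝ A) {w : A → ℝ} {M : ℝ}
    (hw : ∀ c, w c ≤ M) : ∑ c, w c * x c ≤ M :=
  calc ∑ c, w c * x c ≤ ∑ c, M * x c :=
        sum_le_sum fun c _ => mul_le_mul_of_nonneg_right (hw c) (hx.1 c)
    _ = M := by rw [← mul_sum, hx.2, mul_one]

lemma abs_sum_mul_le_of_mem_stdSimplex_s8 (hx : x ∈ stdSimplex ℝ A) {w : A → ℝ} {M : ℝ}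
    (hw : ∀ c, |w c| ≤ M) : |∑ c, w c * x c| ≤ M := by
  refine abs_le.2 ⟨?_, sum_mul_le_of_mem_stdSimplex hx fun c => (abs_le.1 (hw c)).2⟩
  have := sum_mul_le_of_mem_stdSimplex hx (w := fun c => -w c) (M := M)
    fun c => by linarith [(abs_le.1 (hw c)).1]
  simp only [neg_mul, sum_neg_distrib] at this
  linarith

lemma abs_responseValue_le [Nonempty A] (hy : y ∈ stdSimplex ℝ B) {P : A → B → ℝ} {M : ℝ}
    (hP : ∀ c b, |P c b| ≤ M) : |responseValue P y| ≤ M := by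
  obtain ⟨c, hc⟩ := exists_eq_responseValue P y
  rw [hc]
  exact abs_sum_mul_le_of_mem_stdSimplex_s8 hy (hP c)

lemma neg_le_responseValue_add [Nonempty A] [Nonempty B] (hx : x ∈ stdSimplex ℝ A)
    (hy : y ∈ stdSimplex ℝ B) {P : A → B → ℝ} {R : B → A → ℝ} {M : ℝ}
    (hM : ∀ c b, |P c b + R b c| ≤ M) : -M ≤ responseValue P y + responseValue R x := by
  have h1 := sum_mul_le_of_mem_stdSimplex hx fun c => le_responseValue P y c
  have h2 := sum_mul_le_of_mem_stdSimplex hy fun b => le_responseValue R x b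
  have h3 : |∑ c, (∑ b, (P c b + R b c) * y b) * x c| ≤ M :=
    abs_sum_mul_le_of_mem_stdSimplex_s8 hx fun c => abs_sum_mul_le_of_mem_stdSimplex_s8 hy (hM c)
  have h4 : ∑ b, (∑ c, R b c * x c) * y b = ∑ c, (∑ b, R b c * y b) * x c := by
    simp only [sum_mul]
    rw [sum_comm]
    exact sum_congr rfl fun c _ => sum_congr rfl fun b _ => by ring
  have h5 : ∑ c, (∑ b, (P c b + R b c) * y b) * x c
      = ∑ c, (∑ b, P c b * y b) * x c + ∑ c, (∑ b, R b c * y b) * x c := by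
    simp only [add_mul, sum_add_distrib]
  linarith [(abs_le.1 h3).1]

end Simplex

namespace MBFP

lemma vhat1_eq (G : MBFP S A1 A2) (k : ℕ) (s : S) :
    G.vhat1 k s = responseValue (G.Q1 s k) (G.π2 s k) := rfl

lemma vhat2_eq (G : MBFP S A1 A2) (k : ℕ) (s : S) :
    G.vhat2 k s = responseValue (fun b a => G.Q2 s k a b) (G.π1 s k) := by
  simp only [vhat2, responseValue, mul_comm]

lemma p_mem_stdSimplex (G : MBFP S A1 A2) (s : S) (a : A1) (b : A2) :
    G.p s a b ∈ stdSimplex ℝ S :=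
  ⟨G.p_nonneg s a b, G.p_sum_one s a b⟩

lemma Q1_succ (G : MBFP S A1 A2) (s : S) (k : ℕ) (a : A1) (b : A2) :
    G.Q1 s (k + 1) a b = G.Q1 s k a b + (if s = G.st k then G.β (G.cnt s k) else 0)
      * (G.r1 s a b + G.γ * ∑ s', G.vhat1 k s' * G.p s a b s' - G.Q1 s k a b) := by
  rw [G.Q1_upd]; rfl

lemma Q2_succ (G : MBFP S A1 A2) (s : S) (k : ℕ) (a : A1) (b : A2) :
    G.Q2 s (k + 1) a b = G.Q2 s k a b + (if s = G.st k then G.β (G.cnt s k) else 0)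
      * (G.r2 s a b + G.γ * ∑ s', G.vhat2 k s' * G.p s a b s' - G.Q2 s k a b) := by
  rw [G.Q2_upd]; rfl

/-- The beliefs on the Q-functions, and the targets they move towards, stay bounded. -/
lemma exists_bound (G : MBFP S A1 A2) : ∃ C : ℝ, ∀ s k a b,
    |G.Q1 s k a b| ≤ C ∧ |G.Q2 s k a b| ≤ C ∧
    |G.r1 s a b + G.γ * ∑ s', G.vhat1 k s' * G.p s a b s'| ≤ C ∧
    |G.r2 s a b + G.γ * ∑ s', G.vhat2 k s' * G.p s a b s'| ≤ C := by
  obtain ⟨R, hR⟩ : ∃ R : ℝ, ∀ s a b, |G.r1 s a b| ≤ R ∧ |G.r2 s a b| ≤ R := by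
    obtain ⟨R, hR⟩ := (Set.finite_range fun q : S × A1 × A2 => |G.r1 q.1 q.2.1 q.2.2|).bddAbove
    refine ⟨R, fun s a b => ?_⟩
    have h1 : |G.r1 s a b| ≤ R := hR ⟨(s, a, b), rfl⟩
    have h2 : G.r2 s a b = -G.r1 s a b := by linarith [G.zerosum s a b]
    exact ⟨h1, by rwa [h2, abs_neg]⟩
  have hγ : 0 < 1 - G.γ := by linarith [G.γ_lt_one]
  set C := R / (1 - G.γ) with hC
  have hRC : R + G.γ * C = C := by rw [hC]; field_simp; ring
  have hR0 : 0 ≤ R := (abs_nonneg _).trans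
    (hR (Classical.arbitrary S) (Classical.arbitrary A1) (Classical.arbitrary A2)).1
  have hRle : R ≤ C := by
    have : 0 ≤ C := div_nonneg hR0 hγ.le
    nlinarith [G.γ_nonneg]
  have target : ∀ {r : ℝ} {v : S → ℝ} (s a b), |r| ≤ R → (∀ s', |v s'| ≤ C) →
      |r + G.γ * ∑ s', v s' * G.p s a b s'| ≤ C := by
    intro r v s a b hr hv
    refine (abs_add_le _ _).trans ?_
    rw [abs_mul, abs_of_nonneg G.γ_nonneg]
    have := mul_le_mul_of_nonneg_left
      (abs_sum_mul_le_of_mem_stdSimplex_s8 (G.p_mem_stdSimplex s a b) hv) G.γ_nonneg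
    linarith
  have average : ∀ {q u η : ℝ}, 0 ≤ η → η ≤ 1 → |q| ≤ C → |u| ≤ C →
      |q + η * (u - q)| ≤ C := by
    intro q u η h0 h1 hq hu
    rw [abs_le] at *
    constructor <;> nlinarith [hq.1, hq.2, hu.1, hu.2]
  have hQ : ∀ k s a b, |G.Q1 s k a b| ≤ C ∧ |G.Q2 s k a b| ≤ C := by
    intro k
    induction k with
    | zero =>
      intro s a b
      rw [G.Q1_init, G.Q2_init]
      exact ⟨(hR s a b).1.trans hRle, (hR s a b).2.trans hRle⟩
    | succ k ih =>
      intro s a b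
      have hη : 0 ≤ (if s = G.st k then G.β (G.cnt s k) else 0) ∧
          (if s = G.st k then G.β (G.cnt s k) else 0) ≤ 1 := by
        split_ifs
        · exact ⟨(G.β_mem _).1.le, (G.β_mem _).2⟩
        · simp
      rw [G.Q1_succ, G.Q2_succ]
      refine ⟨average hη.1 hη.2 (ih s a b).1 (target s a b (hR s a b).1 fun s' => ?_),
        average hη.1 hη.2 (ih s a b).2 (target s a b (hR s a b).2 fun s' => ?_)⟩
      · exact abs_responseValue_le (G.π2_simplex s' k) fun a b => (ih s' a b).1
      · rw [vhat2_eq]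
        exact abs_responseValue_le (G.π1_simplex s' k) fun b a => (ih s' a b).2
  refine ⟨C, fun s k a b => ⟨(hQ k s a b).1, (hQ k s a b).2, ?_, ?_⟩⟩
  · exact target s a b (hR s a b).1 fun s' =>
      abs_responseValue_le (G.π2_simplex s' k) fun a b => (hQ k s' a b).1
  · refine target s a b (hR s a b).2 fun s' => ?_
    rw [vhat2_eq]
    exact abs_responseValue_le (G.π1_simplex s' k) fun b a => (hQ k s' a b).2

/-- The stage of the `n`-th visit to the state `s`. -/
noncomputable def visit (G : MBFP S A1 A2) (s : S) (n : ℕ) : ℕ :=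
  Nat.nth (fun k => G.st k = s) n

lemma cnt_eq_count (G : MBFP S A1 A2) (s : S) (k : ℕ) :
    G.cnt s k = Nat.count (fun k => G.st k = s) k := by
  rw [Nat.count_eq_card_filter_range]; rfl

section Visit

variable (G : MBFP S A1 A2) {s : S} (hs : Tendsto (fun k => G.cnt s k) atTop atTop)
include hs

lemma infinite_visits : (Set.ofPred fun k => G.st k = s).Infinite := by
  intro hfin
  obtain ⟨k, hk⟩ := (hs.eventually_gt_atTop hfin.toFinset.card).exists
  refine hk.not_ge (card_le_card fun i hi => ?_)
  exact hfin.mem_toFinset.2 (mem_filter.1 hi).2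

lemma st_visit (n : ℕ) : G.st (G.visit s n) = s :=
  Nat.nth_mem_of_infinite (G.infinite_visits hs) n

lemma cnt_visit (n : ℕ) : G.cnt s (G.visit s n) = n := by
  rw [cnt_eq_count]; exact Nat.count_nth_of_infinite (G.infinite_visits hs) n

lemma tendsto_visit : Tendsto (G.visit s) atTop atTop :=
  (Nat.nth_strictMono (G.infinite_visits hs)).tendsto_atTop

lemma apply_visit_cnt {E : Type*} {f : ℕ → E} (hf : ∀ k, G.st k ≠ s → f (k + 1) = f k)
    (k : ℕ) : f (G.visit s (G.cnt s k)) = f k := by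
  have hle : k ≤ G.visit s (G.cnt s k) := by
    rw [cnt_eq_count]; exact Nat.le_nth_count (G.infinite_visits hs) k
  have hne : ∀ m, k ≤ m → m < G.visit s (G.cnt s k) → G.st m ≠ s := by
    intro m hm hlt hst
    rw [cnt_eq_count, visit, Nat.nth_count_eq_sInf] at hlt
    exact Nat.notMem_of_lt_sInf hlt ⟨hst, hm⟩
  have key : ∀ m, k ≤ m → m ≤ G.visit s (G.cnt s k) → f m = f k := by
    intro m hm
    induction m, hm using Nat.le_induction with
    | base => exact fun _ => rfl
    | succ m hm ih =>
      intro hlt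
      rw [hf m (hne m hm hlt), ih (Nat.le_of_succ_le hlt)]
  exact key _ hle le_rfl

lemma apply_visit_succ {E : Type*} {f : ℕ → E} (hf : ∀ k, G.st k ≠ s → f (k + 1) = f k)
    (n : ℕ) : f (G.visit s (n + 1)) = f (G.visit s n + 1) := by
  have : G.cnt s (G.visit s n + 1) = n + 1 := by
    rw [cnt_eq_count]; exact Nat.count_nth_succ_of_infinite (G.infinite_visits hs) n
  rw [← G.apply_visit_cnt hs hf (G.visit s n + 1), this]

lemma π1_visit_succ (n : ℕ) (a : A1) : G.π1 s (G.visit s (n + 1)) a = G.π1 s (G.visit s n) a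
    + G.α n * ((if a = G.astar1 (G.visit s n) then 1 else 0) - G.π1 s (G.visit s n) a) := by
  have h1 := G.apply_visit_succ hs (f := fun k => G.π1 s k a)
    (fun k hk => by rw [G.π1_upd]; simp [hk.symm]) n
  have h2 := G.cnt_visit hs n
  simp only [cnt] at h2
  rw [h1, G.π1_upd, G.st_visit hs, if_pos rfl, h2]

lemma π2_visit_succ (n : ℕ) (b : A2) : G.π2 s (G.visit s (n + 1)) b = G.π2 s (G.visit s n) b
    + G.α n * ((if b = G.astar2 (G.visit s n) then 1 else 0) - G.π2 s (G.visit s n) b) := by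
  have h1 := G.apply_visit_succ hs (f := fun k => G.π2 s k b)
    (fun k hk => by rw [G.π2_upd]; simp [hk.symm]) n
  have h2 := G.cnt_visit hs n
  simp only [cnt] at h2
  rw [h1, G.π2_upd, G.st_visit hs, if_pos rfl, h2]

lemma Q1_visit_succ (n : ℕ) (a : A1) (b : A2) :
    G.Q1 s (G.visit s (n + 1)) a b = G.Q1 s (G.visit s n) a b + G.β n * (G.r1 s a b
      + G.γ * ∑ s', G.vhat1 (G.visit s n) s' * G.p s a b s' - G.Q1 s (G.visit s n) a b) := by
  rw [G.apply_visit_succ hs (f := fun k => G.Q1 s k a b)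
    (fun k hk => by rw [G.Q1_succ]; simp [hk.symm]) n, G.Q1_succ, G.st_visit hs, if_pos rfl,
    G.cnt_visit hs]

lemma Q2_visit_succ (n : ℕ) (a : A1) (b : A2) :
    G.Q2 s (G.visit s (n + 1)) a b = G.Q2 s (G.visit s n) a b + G.β n * (G.r2 s a b
      + G.γ * ∑ s', G.vhat2 (G.visit s n) s' * G.p s a b s' - G.Q2 s (G.visit s n) a b) := by
  rw [G.apply_visit_succ hs (f := fun k => G.Q2 s k a b)
    (fun k hk => by rw [G.Q2_succ]; simp [hk.symm]) n, G.Q2_succ, G.st_visit hs, if_pos rfl,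
    G.cnt_visit hs]

lemma vhat_visit_cnt (k : ℕ) : G.vhat1 (G.visit s (G.cnt s k)) s
    + G.vhat2 (G.visit s (G.cnt s k)) s = G.vhat1 k s + G.vhat2 k s := by
  refine G.apply_visit_cnt hs (f := fun k => G.vhat1 k s + G.vhat2 k s) (fun k hk => ?_) k
  have h1 : G.Q1 s (k + 1) = G.Q1 s k := by rw [G.Q1_upd]; simp [hk.symm]
  have h2 : G.Q2 s (k + 1) = G.Q2 s k := by rw [G.Q2_upd]; simp [hk.symm]
  have h3 : G.π1 s (k + 1) = G.π1 s k := by rw [G.π1_upd]; simp [hk.symm]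
  have h4 : G.π2 s (k + 1) = G.π2 s k := by rw [G.π2_upd]; simp [hk.symm]
  simp only [vhat1, vhat2, h1, h2, h3, h4]

/-- The sum of the two Q-beliefs at a state is asymptotically at most the discounted bound on the
sums of the value estimates. -/
lemma eventually_abs_Q_add_le (hβ : Tendsto (fun n => ∑ c ∈ range n, G.β c) atTop atTop)
    {W δ : ℝ} (hδ : 0 < δ) (hW : ∀ᶠ k in atTop, ∀ s', |G.vhat1 k s' + G.vhat2 k s'| ≤ W) :
    ∀ᶠ n in atTop, ∀ a b,
      |G.Q1 s (G.visit s n) a b + G.Q2 s (G.visit s n) a b| ≤ G.γ * W + δ := by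
  refine eventually_all.2 fun a => eventually_all.2 fun b => ?_
  refine eventually_abs_le_of_averaging (β := G.β) (w := fun n => G.γ *
    ∑ s', (G.vhat1 (G.visit s n) s' + G.vhat2 (G.visit s n) s') * G.p s a b s')
    G.β_mem hβ (fun n => ?_) hδ ?_
  · rw [G.Q1_visit_succ hs, G.Q2_visit_succ hs]
    simp only [add_mul, sum_add_distrib]
    linear_combination G.β n * G.zerosum s a b
  · filter_upwards [(G.tendsto_visit hs).eventually hW] with n hn
    rw [abs_mul, abs_of_nonneg G.γ_nonneg]
    exact mul_le_mul_of_nonneg_left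
      (abs_sum_mul_le_of_mem_stdSimplex_s8 (G.p_mem_stdSimplex s a b) hn) G.γ_nonneg

end Visit

/-- Each discounting step contracts asymptotic bounds on the sums of the value estimates. -/
lemma eventually_abs_vhat_add_le (G : MBFP S A1 A2) (h : G.Assumption1) {W δ : ℝ} (hδ : 0 < δ)
    (hW : ∀ᶠ k in atTop, ∀ s, |G.vhat1 k s + G.vhat2 k s| ≤ W) :
    ∀ᶠ k in atTop, ∀ s, |G.vhat1 k s + G.vhat2 k s| ≤ G.γ * W + δ := by
  obtain ⟨hcnt, hα, hβ, hα0, -, hβα⟩ := h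
  refine eventually_all.2 fun s => ?_
  have hs := hcnt s
  obtain ⟨C, hC⟩ := G.exists_bound
  have hε : Tendsto (fun n => 2 * C * (G.β n / G.α n)) atTop (𝓝 0) := by
    simpa using hβα.const_mul (2 * C)
  have slow : ∀ n (u q : ℝ), |u| ≤ C → |q| ≤ C →
      |q + G.β n * (u - q) - q| ≤ 2 * C * (G.β n / G.α n) * G.α n := by
    intro n u q hu hq
    rw [add_sub_cancel_left, abs_mul, abs_of_pos (G.β_mem n).1, mul_assoc,
      div_mul_cancel₀ _ (G.α_mem n).1.ne', mul_comm]
    refine mul_le_mul_of_nonneg_right ?_ (G.β_mem n).1.le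
    linarith [abs_sub u q]
  have play1 : FictitiousPlay G.α (fun n => 2 * C * (G.β n / G.α n)) C
      (fun n => G.π1 s (G.visit s n)) (fun n => G.π2 s (G.visit s n))
      (fun n => G.Q1 s (G.visit s n)) (fun n => G.astar1 (G.visit s n)) :=
    { mem_simplex := fun n => G.π1_simplex _ _
      update := fun n a => G.π1_visit_succ hs n a
      best_response := fun n a => by
        have := G.astar1_br (G.visit s n) a
        rwa [G.st_visit hs] at this
      bounded := fun n a b => (hC _ _ _ _).1
      slow := fun n a b => by
        rw [G.Q1_visit_succ hs]
        exact slow n _ _ (hC _ _ _ _).2.2.1 (hC _ _ _ _).1 }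
  have play2 : FictitiousPlay G.α (fun n => 2 * C * (G.β n / G.α n)) C
      (fun n => G.π2 s (G.visit s n)) (fun n => G.π1 s (G.visit s n))
      (fun n b a => G.Q2 s (G.visit s n) a b) (fun n => G.astar2 (G.visit s n)) :=
    { mem_simplex := fun n => G.π2_simplex _ _
      update := fun n b => G.π2_visit_succ hs n b
      best_response := fun n b => by
        have := G.astar2_br (G.visit s n) b
        rw [G.st_visit hs] at this
        simpa only [mul_comm] using this
      bounded := fun n b a => (hC _ _ _ _).2.1
      slow := fun n b a => by
        rw [G.Q2_visit_succ hs]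
        exact slow n _ _ (hC _ _ _ _).2.2.2 (hC _ _ _ _).2.1 }
  have hQ := G.eventually_abs_Q_add_le hs hβ (half_pos hδ) hW
  have hup := play1.eventually_responseValue_add_le G.α_mem hα hα0 hε play2 (half_pos hδ)
    (hQ.mono fun n hn a b => (abs_le.1 (hn a b)).2)
  filter_upwards [hs.eventually hup, hs.eventually hQ] with k h1 h2
  rw [← G.vhat_visit_cnt hs, vhat1_eq, vhat2_eq, abs_le]
  have h3 := neg_le_responseValue_add (G.π1_simplex s (G.visit s (G.cnt s k)))
    (G.π2_simplex s (G.visit s (G.cnt s k)))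
    (R := fun b a => G.Q2 s (G.visit s (G.cnt s k)) a b) h2
  constructor <;> linarith

end MBFP

/-- The two players' estimates of continuation payoffs asymptotically sum to zero
at every state. -/
theorem v_estimates_sum_to_zero (G : MBFP S A1 A2) (h : G.Assumption1) (s : S) :
    Tendsto (fun k => G.vhat1 k s + G.vhat2 k s) atTop (𝓝 0) := by
  obtain ⟨C, hC⟩ := G.exists_bound
  have hC0 : 0 ≤ C := (abs_nonneg _).trans
    (hC s 0 (Classical.arbitrary A1) (Classical.arbitrary A2)).1
  have hγ := G.γ_nonneg
  have hγ1 := G.γ_lt_one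
  have geometric : ∀ m : ℕ, ∀ δ > 0, ∀ᶠ k in atTop, ∀ s,
      |G.vhat1 k s + G.vhat2 k s| ≤ G.γ ^ m * (2 * C) + δ := by
    intro m
    induction m with
    | zero =>
      refine fun δ hδ => Eventually.of_forall fun k s => ?_
      have h1 : |G.vhat1 k s| ≤ C :=
        abs_responseValue_le (G.π2_simplex s k) fun a b => (hC s k a b).1
      have h2 : |G.vhat2 k s| ≤ C := by
        rw [G.vhat2_eq]
        exact abs_responseValue_le (G.π1_simplex s k) fun b a => (hC s k a b).2.1
      rw [pow_zero, one_mul]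
      linarith [abs_add_le (G.vhat1 k s) (G.vhat2 k s)]
    | succ m ih =>
      intro δ hδ
      filter_upwards [G.eventually_abs_vhat_add_le h (half_pos hδ) (ih (δ / 2) (half_pos hδ))]
        with k hk s
      refine (hk s).trans ?_
      rw [pow_succ]
      nlinarith
  refine Metric.tendsto_nhds.2 fun δ hδ => ?_
  have hpow : Tendsto (fun m : ℕ => G.γ ^ m * (2 * C)) atTop (𝓝 0) := by
    simpa using (tendsto_pow_atTop_nhds_zero_of_lt_one hγ hγ1).mul_const (2 * C)
  obtain ⟨m, hm⟩ := (hpow.eventually (gt_mem_nhds (half_pos hδ))).exists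
  filter_upwards [geometric m (δ / 2) (half_pos hδ)] with k hk
  rw [Real.dist_eq, sub_zero]
  linarith [hk s]
end
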